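/- arXiv:2603.03889 — 2 statements merged into one kernel-verified Lean document; each statement's English description precedes it below -/
import Mathlib

section
/- The set E(0,0) = {x ∈ (0,1] : lim_{n→∞} ℓ_n(x)/n = 0} has Lebesgue measure 1, and consequently its Hausdorff dimension equals 1. -/
open Filter MeasureTheory Set

/-- The Lüroth transformation on (0,1]. -/
noncomputable def lurothT (x : ℝ) : ℝ :=
  (⌊1/x⌋ : ℝ) * ((⌊1/x⌋ : ℝ) + 1) * (x - 1/((⌊1/x⌋ : ℝ) + 1))

/-- The n-th Lüroth digit (n ≥ 1): d₁(x) = ⌊1/x⌋ + 1, dₙ(x) = d₁(T^[n-1] x). -/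
noncomputable def lurothD (n : ℕ) (x : ℝ) : ℕ :=
  (⌊1 / (lurothT^[n-1] x)⌋ + 1).toNat

/-- The n-th maximal run-length function. -/
noncomputable def runLen (n : ℕ) (x : ℝ) : ℕ :=
  sSup {k : ℕ | 1 ≤ k ∧ ∃ j : ℕ, j + k ≤ n ∧
    ∀ i : ℕ, 1 ≤ i → i ≤ k → lurothD (j + i) x = lurothD (j + 1) x}

/-- The level set E(α,β). -/
noncomputable def Eab (a b : ℝ) : Set ℝ :=
  {x | x ∈ Set.Ioc (0:ℝ) 1 ∧
    Filter.liminf (fun n : ℕ => (runLen n x : ℝ) / n) Filter.atTop = a ∧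
    Filter.limsup (fun n : ℕ => (runLen n x : ℝ) / n) Filter.atTop = b}

/-- The series ∑_{t=2}^∞ (1/(2^u t(t-1)))^s. -/
noncomputable def lurothF (u s : ℝ) : ℝ :=
  ∑' t : ℕ, (1 / (2 ^ u * ((t : ℝ) + 2) * ((t : ℝ) + 1))) ^ s

/-- If `⌊1/y⌋ = d + 1`, then the Lüroth map is affine at `y`, and maps `y` into `(0,1]`. -/
lemma lurothT_eq_of_floor {y : ℝ} (hy : y ∈ Ioc (0:ℝ) 1) {d : ℕ} (hd : ⌊1 / y⌋ = (d:ℤ) + 1) :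
    lurothT y = ((d:ℝ) + 1) * (d + 2) * (y + -(1 / ((d:ℝ) + 2))) ∧ lurothT y ∈ Ioc (0:ℝ) 1 := by
  have hT : lurothT y = ((d:ℝ) + 1) * (d + 2) * (y + -(1 / ((d:ℝ) + 2))) := by
    unfold lurothT
    rw [hd]
    push_cast
    ring
  refine ⟨hT, ?_⟩
  obtain ⟨h1, h2⟩ := Int.floor_eq_iff.1 hd
  push_cast at h1 h2
  have hy0 := hy.1
  rw [le_div_iff₀ hy0] at h1
  rw [div_lt_iff₀ hy0] at h2
  have h3 : ((d:ℝ) + 1) * (d + 2) * (y + -(1 / ((d:ℝ) + 2))) = (d + 1) * ((d + 2) * y - 1) := by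
    field_simp
    ring
  have hd0 : (0:ℝ) ≤ d := d.cast_nonneg
  rw [hT, h3]
  constructor
  · apply mul_pos <;> linarith
  · nlinarith

lemma exists_floor_one_div_eq {y : ℝ} (hy : y ∈ Ioc (0:ℝ) 1) : ∃ d : ℕ, ⌊1 / y⌋ = (d:ℤ) + 1 := by
  have h : (1:ℤ) ≤ ⌊1 / y⌋ := by
    rw [Int.le_floor, Int.cast_one, le_div_iff₀ hy.1]
    linarith [hy.2]
  exact ⟨(⌊1 / y⌋ - 1).toNat, by omega⟩

lemma lurothT_mem {y : ℝ} (hy : y ∈ Ioc (0:ℝ) 1) : lurothT y ∈ Ioc (0:ℝ) 1 :=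
  let ⟨_, hd⟩ := exists_floor_one_div_eq hy
  (lurothT_eq_of_floor hy hd).2

lemma lurothT_iterate_mem {y : ℝ} (hy : y ∈ Ioc (0:ℝ) 1) (n : ℕ) :
    lurothT^[n] y ∈ Ioc (0:ℝ) 1 := by
  induction n with
  | zero => exact hy
  | succ n ih =>
    rw [Function.iterate_succ_apply']
    exact lurothT_mem ih

/-- The length of the set of points with first Lüroth digit `d + 2`. -/
noncomputable def lurothWeight (d : ℕ) : ENNReal :=
  ENNReal.ofReal (1 / (((d:ℝ) + 1) * (d + 2)))

lemma lurothWeight_le_half (d : ℕ) : lurothWeight d ≤ ENNReal.ofReal (1 / 2) := by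
  apply ENNReal.ofReal_le_ofReal
  have hd0 : (0:ℝ) ≤ d := d.cast_nonneg
  apply one_div_le_one_div_of_le <;> nlinarith

lemma tsum_lurothWeight_le_one : ∑' d, lurothWeight d ≤ 1 := by
  apply ENNReal.tsum_le_of_sum_range_le
  intro n
  have h : ∀ n : ℕ, ∑ d ∈ Finset.range n, 1 / (((d:ℝ) + 1) * (d + 2)) = 1 - 1 / ((n:ℝ) + 1) := by
    intro n
    induction n with
    | zero => simp
    | succ n ih =>
      rw [Finset.sum_range_succ, ih]
      push_cast
      field_simp
      ring
  unfold lurothWeight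
  rw [← ENNReal.ofReal_sum_of_nonneg (fun i _ => by positivity), h]
  apply ENNReal.ofReal_le_one.2
  have : (0:ℝ) ≤ 1 / ((n:ℝ) + 1) := by positivity
  linarith

lemma volume_floor_eq_inter_preimage_lurothT_le (d : ℕ) (A : Set ℝ) :
    volume {y | y ∈ Ioc (0:ℝ) 1 ∧ ⌊1 / y⌋ = (d:ℤ) + 1 ∧ lurothT y ∈ A} ≤
      lurothWeight d * volume A := by
  have hc : (0:ℝ) < ((d:ℝ) + 1) * (d + 2) := by positivity
  calc volume {y | y ∈ Ioc (0:ℝ) 1 ∧ ⌊1 / y⌋ = (d:ℤ) + 1 ∧ lurothT y ∈ A}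
      ≤ volume ((fun y : ℝ => y + -(1 / ((d:ℝ) + 2))) ⁻¹'
          ((fun y : ℝ => ((d:ℝ) + 1) * (d + 2) * y) ⁻¹' A)) := by
        apply measure_mono
        rintro y ⟨hy, hd, hA⟩
        rw [(lurothT_eq_of_floor hy hd).1] at hA
        exact hA
    _ = lurothWeight d * volume A := by
        rw [measure_preimage_add_right, Real.volume_preimage_mul_left hc.ne',
          abs_of_pos (inv_pos.2 hc), lurothWeight, one_div]

lemma volume_preimage_lurothT_le (A : Set ℝ) :
    volume {y | y ∈ Ioc (0:ℝ) 1 ∧ lurothT y ∈ A} ≤ volume A := by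
  calc volume {y | y ∈ Ioc (0:ℝ) 1 ∧ lurothT y ∈ A}
      ≤ volume (⋃ d : ℕ, {y | y ∈ Ioc (0:ℝ) 1 ∧ ⌊1 / y⌋ = (d:ℤ) + 1 ∧ lurothT y ∈ A}) := by
        apply measure_mono
        rintro y ⟨hy, hA⟩
        obtain ⟨d, hd⟩ := exists_floor_one_div_eq hy
        exact mem_iUnion.2 ⟨d, hy, hd, hA⟩
    _ ≤ ∑' d, lurothWeight d * volume A :=
        (measure_iUnion_le _).trans
          (ENNReal.tsum_le_tsum fun d => volume_floor_eq_inter_preimage_lurothT_le d A)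
    _ ≤ 1 * volume A := by
        rw [ENNReal.tsum_mul_right]
        gcongr
        exact tsum_lurothWeight_le_one
    _ = volume A := one_mul _

lemma volume_preimage_lurothT_iterate_le (m : ℕ) (A : Set ℝ) :
    volume {y | y ∈ Ioc (0:ℝ) 1 ∧ lurothT^[m] y ∈ A} ≤ volume A := by
  induction m with
  | zero => exact measure_mono fun y hy => hy.2
  | succ m ih =>
    refine le_trans (measure_mono ?_) ((volume_preimage_lurothT_le _).trans ih)
    rintro y ⟨hy, hA⟩
    exact ⟨hy, lurothT_mem hy, hA⟩

lemma volume_constant_digits_le (d k : ℕ) :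
    volume {y | y ∈ Ioc (0:ℝ) 1 ∧ ∀ i < k, ⌊1 / lurothT^[i] y⌋ = (d:ℤ) + 1} ≤
      lurothWeight d ^ k := by
  induction k with
  | zero =>
    calc _ ≤ volume (Ioc (0:ℝ) 1) := measure_mono fun y hy => hy.1
      _ ≤ lurothWeight d ^ 0 := by simp
  | succ k ih =>
    rw [pow_succ']
    refine le_trans (measure_mono ?_)
      ((volume_floor_eq_inter_preimage_lurothT_le d _).trans (mul_le_mul_right ih _))
    rintro y ⟨hy, h⟩
    refine ⟨hy, h 0 k.succ_pos, lurothT_mem hy, fun i hi => ?_⟩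
    exact h (i + 1) (by omega)

/-- The points of `(0,1]` whose first `k + 1` Lüroth digits coincide. -/
def initialRun (k : ℕ) : Set ℝ :=
  {y | y ∈ Ioc (0:ℝ) 1 ∧ ∀ i < k + 1, ⌊1 / lurothT^[i] y⌋ = ⌊1 / y⌋}

lemma volume_initialRun_le (k : ℕ) : volume (initialRun k) ≤ ENNReal.ofReal (1 / 2) ^ k := by
  calc volume (initialRun k)
      ≤ volume (⋃ d : ℕ,
          {y | y ∈ Ioc (0:ℝ) 1 ∧ ∀ i < k + 1, ⌊1 / lurothT^[i] y⌋ = (d:ℤ) + 1}) := by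
        apply measure_mono
        rintro y ⟨hy, h⟩
        obtain ⟨d, hd⟩ := exists_floor_one_div_eq hy
        exact mem_iUnion.2 ⟨d, hy, fun i hi => (h i hi).trans hd⟩
    _ ≤ ∑' d, ENNReal.ofReal (1 / 2) ^ k * lurothWeight d := by
        refine (measure_iUnion_le _).trans (ENNReal.tsum_le_tsum fun d => ?_)
        refine (volume_constant_digits_le d (k + 1)).trans ?_
        rw [pow_succ]
        gcongr
        exact lurothWeight_le_half d
    _ ≤ ENNReal.ofReal (1 / 2) ^ k * 1 := by
        rw [ENNReal.tsum_mul_left]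
        gcongr
        exact tsum_lurothWeight_le_one
    _ = ENNReal.ofReal (1 / 2) ^ k := mul_one _

lemma exists_iterate_mem_initialRun {x : ℝ} (hx : x ∈ Ioc (0:ℝ) 1) {n k : ℕ}
    (h : k < runLen n x) : ∃ j < n, lurothT^[j] x ∈ initialRun k := by
  have hne : {k : ℕ | 1 ≤ k ∧ ∃ j : ℕ, j + k ≤ n ∧
      ∀ i : ℕ, 1 ≤ i → i ≤ k → lurothD (j + i) x = lurothD (j + 1) x}.Nonempty := by
    by_contra hempty
    rw [not_nonempty_iff_eq_empty] at hempty
    rw [runLen, hempty] at h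
    simp at h
  have hmem := Nat.sSup_mem hne ⟨n, fun k ⟨_, j, hj, _⟩ => by omega⟩
  obtain ⟨_, j, hj, hrun⟩ := hmem
  rw [← runLen] at hj hrun
  refine ⟨j, by omega, lurothT_iterate_mem hx j, fun i hi => ?_⟩
  have hdig := hrun (i + 1) (by omega) (by omega)
  simp only [lurothD, ← add_assoc, Nat.add_sub_cancel] at hdig
  obtain ⟨a, ha⟩ := exists_floor_one_div_eq (lurothT_iterate_mem hx (j + i))
  obtain ⟨b, hb⟩ := exists_floor_one_div_eq (lurothT_iterate_mem hx j)
  rw [← Function.iterate_add_apply, add_comm i j]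
  omega

lemma volume_lt_runLen_le (n k : ℕ) :
    volume {x | x ∈ Ioc (0:ℝ) 1 ∧ k < runLen n x} ≤ n * ENNReal.ofReal (1 / 2) ^ k := by
  calc volume {x | x ∈ Ioc (0:ℝ) 1 ∧ k < runLen n x}
      ≤ volume (⋃ j ∈ Finset.range n, {x | x ∈ Ioc (0:ℝ) 1 ∧ lurothT^[j] x ∈ initialRun k}) := by
        apply measure_mono
        rintro x ⟨hx, h⟩
        obtain ⟨j, hj, hmem⟩ := exists_iterate_mem_initialRun hx h
        exact mem_iUnion₂.2 ⟨j, Finset.mem_range.2 hj, hx, hmem⟩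
    _ ≤ ∑ j ∈ Finset.range n, ENNReal.ofReal (1 / 2) ^ k :=
        (measure_biUnion_finset_le _ _).trans (Finset.sum_le_sum fun j _ =>
          (volume_preimage_lurothT_iterate_le j _).trans (volume_initialRun_le k))
    _ = n * ENNReal.ofReal (1 / 2) ^ k := by simp

lemma half_pow_floor_mul_le (ε : ℝ) (n : ℕ) :
    (1 / 2 : ℝ) ^ ⌊ε * n⌋₊ ≤ 2 * ((1 / 2 : ℝ) ^ ε) ^ n := by
  have h1 : ((1 / 2 : ℝ) ^ ε) ^ n = (1 / 2 : ℝ) ^ (ε * n) := by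
    rw [← Real.rpow_natCast, ← Real.rpow_mul (by norm_num)]
  have h2 : (1 / 2 : ℝ) ^ (⌊ε * n⌋₊ : ℝ) ≤ (1 / 2 : ℝ) ^ (ε * n - 1) :=
    Real.rpow_le_rpow_of_exponent_ge (by norm_num) (by norm_num) (Nat.sub_one_lt_floor _).le
  rw [Real.rpow_sub (by norm_num), Real.rpow_one, Real.rpow_natCast, ← h1] at h2
  linarith

lemma summable_nat_mul_half_pow_floor {ε : ℝ} (hε : 0 < ε) :
    Summable fun n : ℕ => (n:ℝ) * (1 / 2 : ℝ) ^ ⌊ε * n⌋₊ := by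
  have hr0 : 0 < (1 / 2 : ℝ) ^ ε := by positivity
  have hr1 : (1 / 2 : ℝ) ^ ε < 1 := Real.rpow_lt_one (by norm_num) (by norm_num) hε
  have hle := half_pow_floor_mul_le ε
  generalize (1 / 2 : ℝ) ^ ε = r at hr0 hr1 hle
  have hnorm : ‖r‖ < 1 := by rwa [Real.norm_of_nonneg hr0.le]
  have hsum : Summable fun n : ℕ => 2 * ((n:ℝ) ^ 1 * r ^ n) :=
    (summable_pow_mul_geometric_of_norm_lt_one 1 hnorm).mul_left 2
  refine Summable.of_nonneg_of_le (fun n => by positivity) (fun n => ?_) hsum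
  have h := mul_le_mul_of_nonneg_left (hle n) n.cast_nonneg
  rw [pow_one]
  linarith

lemma ae_eventually_runLen_le {ε : ℝ} (hε : 0 < ε) :
    ∀ᵐ x : ℝ, x ∈ Ioc (0:ℝ) 1 → ∀ᶠ n : ℕ in atTop, (runLen n x : ℝ) ≤ ε * n := by
  have hbound : ∀ n : ℕ, volume {x | x ∈ Ioc (0:ℝ) 1 ∧ ⌊ε * n⌋₊ < runLen n x} ≤
      ENNReal.ofReal ((n:ℝ) * (1 / 2 : ℝ) ^ ⌊ε * n⌋₊) := by
    intro n
    rw [ENNReal.ofReal_mul n.cast_nonneg, ENNReal.ofReal_natCast,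
      ENNReal.ofReal_pow (by norm_num)]
    exact volume_lt_runLen_le n _
  have hbc := ae_eventually_notMem (μ := volume)
    (s := fun n : ℕ => {x | x ∈ Ioc (0:ℝ) 1 ∧ ⌊ε * n⌋₊ < runLen n x})
    (ne_top_of_le_ne_top (summable_nat_mul_half_pow_floor hε).tsum_ofReal_ne_top
      (ENNReal.tsum_le_tsum hbound))
  filter_upwards [hbc] with x hx hmem
  filter_upwards [hx] with n hn
  exact (Nat.le_floor_iff (by positivity)).1 (not_lt.1 fun h => hn ⟨hmem, h⟩)

lemma ae_tendsto_runLen_div :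
    ∀ᵐ x : ℝ, x ∈ Ioc (0:ℝ) 1 → Tendsto (fun n : ℕ => (runLen n x : ℝ) / n) atTop (nhds 0) := by
  have h := ae_all_iff.2 fun q : ℕ => ae_eventually_runLen_le (ε := 1 / ((q:ℝ) + 1)) (by positivity)
  filter_upwards [h] with x hx hmem
  rw [Metric.tendsto_atTop']
  intro ε hε
  obtain ⟨q, hq⟩ := exists_nat_one_div_lt hε
  obtain ⟨N, hN⟩ := eventually_atTop.1 (hx q hmem)
  refine ⟨N, fun n hn => ?_⟩
  have hn0 : (0:ℝ) < n := by exact_mod_cast (Nat.zero_le N).trans_lt hn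
  rw [Real.dist_0_eq_abs, abs_of_nonneg (by positivity)]
  exact ((div_le_iff₀ hn0).2 (hN n hn.le)).trans_lt hq

/-- E(0,0) = {x ∈ (0,1] : ℓₙ(x)/n → 0} has Lebesgue measure 1, hence Hausdorff dimension 1. -/
theorem luroth_E00_full_measure :
    volume {x : ℝ | x ∈ Set.Ioc (0:ℝ) 1 ∧
        Filter.Tendsto (fun n : ℕ => (runLen n x : ℝ) / n) Filter.atTop (nhds 0)} = 1 ∧
    dimH {x : ℝ | x ∈ Set.Ioc (0:ℝ) 1 ∧
        Filter.Tendsto (fun n : ℕ => (runLen n x : ℝ) / n) Filter.atTop (nhds 0)} = 1 := by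
  have hvol : volume {x : ℝ | x ∈ Set.Ioc (0:ℝ) 1 ∧
      Filter.Tendsto (fun n : ℕ => (runLen n x : ℝ) / n) Filter.atTop (nhds 0)} = 1 := by
    have h : volume (Ioc (0:ℝ) 1) = 1 := by simp
    rw [← h]
    apply measure_congr
    filter_upwards [ae_tendsto_runLen_div] with x hx
    exact propext ⟨fun hmem => hmem.1, fun hmem => ⟨hmem, hx hmem⟩⟩
  refine ⟨hvol, le_antisymm ?_ ?_⟩
  · exact (dimH_mono (subset_univ _)).trans Real.dimH_univ.le
  · apply le_dimH_of_hausdorffMeasure_ne_zero (d := 1)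
    rw [NNReal.coe_one, hausdorffMeasure_real, hvol]
    exact one_ne_zero
end

section
/- For every 0 < β < 1, the Hausdorff dimension of E(0,β) equals s(β/(1−β)). -/
open Filter MeasureTheory Set

/-- The length of the first-level Lüroth cylinder with digit `t + 2`. -/
noncomputable def lurothRho (t : ℕ) : ℝ := 1 / (((t : ℝ) + 2) * ((t : ℝ) + 1))

lemma lurothRho_pos (t : ℕ) : 0 < lurothRho t := by
  unfold lurothRho; positivity

lemma lurothRho_le_half (t : ℕ) : lurothRho t ≤ 1 / 2 := by
  unfold lurothRho
  apply one_div_le_one_div_of_le (by norm_num)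
  have : (0 : ℝ) ≤ t := t.cast_nonneg
  nlinarith

lemma lurothRho_zero : lurothRho 0 = 1 / 2 := by norm_num [lurothRho]

lemma lurothRho_one : lurothRho 1 = 1 / 6 := by norm_num [lurothRho]

/-- The inverse branch of the Lüroth transformation with digit `t + 2`. -/
noncomputable def lurothBranch (t : ℕ) (y : ℝ) : ℝ := 1 / ((t : ℝ) + 2) + lurothRho t * y

lemma lurothBranch_one (t : ℕ) : lurothBranch t 1 = 1 / ((t : ℝ) + 1) := by
  unfold lurothBranch lurothRho
  field_simp
  ring

lemma lurothBranch_le {t : ℕ} {y : ℝ} (hy : y ≤ 1) : lurothBranch t y ≤ 1 / ((t : ℝ) + 1) := by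
  rw [← lurothBranch_one]
  unfold lurothBranch
  have := lurothRho_pos t
  gcongr

lemma lt_lurothBranch {t : ℕ} {y : ℝ} (hy : 0 < y) : 1 / ((t : ℝ) + 2) < lurothBranch t y := by
  unfold lurothBranch
  have := mul_pos (lurothRho_pos t) hy
  linarith

lemma lurothBranch_mem {t : ℕ} {y : ℝ} (hy : y ∈ Ioc (0 : ℝ) 1) :
    lurothBranch t y ∈ Ioc (0 : ℝ) 1 := by
  constructor
  · exact lt_trans (by positivity) (lt_lurothBranch hy.1)
  · refine (lurothBranch_le hy.2).trans ?_
    rw [div_le_one (by positivity)]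
    have : (0 : ℝ) ≤ t := t.cast_nonneg
    linarith

lemma floor_one_div_lurothBranch {t : ℕ} {y : ℝ} (hy : y ∈ Ioc (0 : ℝ) 1) :
    ⌊1 / lurothBranch t y⌋ = (t : ℤ) + 1 := by
  have hx := (lurothBranch_mem (t := t) hy).1
  rw [Int.floor_eq_iff]
  push_cast
  constructor
  · rw [le_div_iff₀ hx]
    have := lurothBranch_le (t := t) hy.2
    rw [le_div_iff₀ (by positivity)] at this
    linarith
  · rw [div_lt_iff₀ hx]
    have := lt_lurothBranch (t := t) hy.1
    rw [div_lt_iff₀ (by positivity)] at this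
    linarith

lemma lurothT_lurothBranch {t : ℕ} {y : ℝ} (hy : y ∈ Ioc (0 : ℝ) 1) :
    lurothT (lurothBranch t y) = y := by
  unfold lurothT
  rw [floor_one_div_lurothBranch hy]
  unfold lurothBranch lurothRho
  push_cast
  field_simp
  ring

lemma lurothD_one_lurothBranch {t : ℕ} {y : ℝ} (hy : y ∈ Ioc (0 : ℝ) 1) :
    lurothD 1 (lurothBranch t y) = t + 2 := by
  unfold lurothD
  simp only [Nat.sub_self, Function.iterate_zero, id_eq]
  rw [floor_one_div_lurothBranch hy]
  omega

lemma exists_lurothBranch_eq {x : ℝ} (hx : x ∈ Ioc (0 : ℝ) 1) :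
    ∃ t : ℕ, ∃ y ∈ Ioc (0 : ℝ) 1, x = lurothBranch t y := by
  have hx0 := hx.1
  have h1 : 1 ≤ ⌊1 / x⌋₊ := by
    rw [Nat.one_le_floor_iff, le_div_iff₀ hx0]
    linarith [hx.2]
  obtain ⟨t, ht⟩ : ∃ t, ⌊1 / x⌋₊ = t + 1 := ⟨⌊1 / x⌋₊ - 1, by omega⟩
  rw [Nat.floor_eq_iff (by positivity)] at ht
  push_cast at ht
  rw [le_div_iff₀ hx0, div_lt_iff₀ hx0] at ht
  have hr : lurothRho t * (((t : ℝ) + 2) * ((t : ℝ) + 1)) = 1 := by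
    unfold lurothRho; field_simp
  have h2 : (1 : ℝ) / (t + 2) * (t + 2) = 1 := by field_simp
  refine ⟨t, (((t : ℝ) + 1) * ((t + 2) * x - 1)), ⟨?_, ?_⟩, ?_⟩
  · have : 0 < ((t : ℝ) + 2) * x - 1 := by linarith
    positivity
  · have : (0 : ℝ) ≤ t := t.cast_nonneg
    nlinarith
  · unfold lurothBranch lurothRho
    field_simp
    ring

lemma lurothT_mem_s3 {x : ℝ} (hx : x ∈ Ioc (0 : ℝ) 1) : lurothT x ∈ Ioc (0 : ℝ) 1 := by
  obtain ⟨t, y, hy, rfl⟩ := exists_lurothBranch_eq hx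
  rwa [lurothT_lurothBranch hy]

lemma lurothD_succ_succ (n : ℕ) (x : ℝ) : lurothD (n + 2) x = lurothD (n + 1) (lurothT x) := by
  simp [lurothD]

lemma lurothBranch_of_lurothD_one {x : ℝ} (hx : x ∈ Ioc (0 : ℝ) 1) {t : ℕ}
    (ht : lurothD 1 x = t + 2) : x = lurothBranch t (lurothT x) := by
  obtain ⟨t', y, hy, rfl⟩ := exists_lurothBranch_eq hx
  rw [lurothD_one_lurothBranch hy] at ht
  obtain rfl : t' = t := by omega
  rw [lurothT_lurothBranch hy]

lemma exists_lurothD_eq {x : ℝ} (hx : x ∈ Ioc (0 : ℝ) 1) (n : ℕ) :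
    ∃ t, lurothD (n + 1) x = t + 2 := by
  induction n generalizing x with
  | zero =>
    obtain ⟨t, y, hy, rfl⟩ := exists_lurothBranch_eq hx
    exact ⟨t, lurothD_one_lurothBranch hy⟩
  | succ n ih =>
    rw [lurothD_succ_succ]
    exact ih (lurothT_mem_s3 hx)

/-- The Lüroth cylinder of order `n` with digits `v i + 2`. -/
def lurothCyl (n : ℕ) (v : ℕ → ℕ) : Set ℝ :=
  {x | x ∈ Ioc (0 : ℝ) 1 ∧ ∀ i < n, lurothD (i + 1) x = v i + 2}

lemma abs_sub_le_of_mem_lurothCyl {n : ℕ} {v : ℕ → ℕ} {x x' : ℝ}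
    (hx : x ∈ lurothCyl n v) (hx' : x' ∈ lurothCyl n v) :
    |x - x'| ≤ ∏ i ∈ Finset.range n, lurothRho (v i) := by
  induction n generalizing v x x' with
  | zero =>
    obtain ⟨⟨h1, h2⟩, -⟩ := hx
    obtain ⟨⟨h3, h4⟩, -⟩ := hx'
    rw [abs_le]
    constructor <;> simp <;> linarith
  | succ n ih =>
    have key : ∀ {z : ℝ}, z ∈ lurothCyl (n + 1) v → lurothT z ∈ lurothCyl n (fun i => v (i + 1)) :=
      fun {z} hz => ⟨lurothT_mem_s3 hz.1, fun i hi => by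
        rw [← lurothD_succ_succ]; exact hz.2 (i + 1) (by omega)⟩
    rw [lurothBranch_of_lurothD_one hx.1 (hx.2 0 (by omega)),
      lurothBranch_of_lurothD_one hx'.1 (hx'.2 0 (by omega)), Finset.prod_range_succ']
    have := ih (key hx) (key hx')
    have hr := lurothRho_pos (v 0)
    unfold lurothBranch
    calc _ = |lurothT x - lurothT x'| * lurothRho (v 0) := by
          rw [show ∀ a b c d : ℝ, a + b * c - (a + b * d) = (c - d) * b by intros; ring,
            abs_mul, abs_of_pos hr]
      _ ≤ _ := by gcongr

lemma ediam_lurothCyl_le (n : ℕ) (v : ℕ → ℕ) :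
    Metric.ediam (lurothCyl n v) ≤ ENNReal.ofReal (∏ i ∈ Finset.range n, lurothRho (v i)) := by
  refine Metric.ediam_le fun x hx y hy => ?_
  rw [edist_dist, Real.dist_eq]
  exact ENNReal.ofReal_le_ofReal (abs_sub_le_of_mem_lurothCyl hx hy)

lemma bddAbove_runs (n : ℕ) (x : ℝ) : BddAbove {k : ℕ | 1 ≤ k ∧ ∃ j : ℕ, j + k ≤ n ∧
    ∀ i : ℕ, 1 ≤ i → i ≤ k → lurothD (j + i) x = lurothD (j + 1) x} :=
  ⟨n, fun k hk => by obtain ⟨-, j, hj, -⟩ := hk; omega⟩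

lemma le_runLen {n j k : ℕ} {x : ℝ} (hk : 1 ≤ k) (hjk : j + k ≤ n)
    (h : ∀ i < k, lurothD (j + i + 1) x = lurothD (j + 1) x) : k ≤ runLen n x := by
  refine le_csSup (bddAbove_runs n x) ⟨hk, j, hjk, fun i h1 h2 => ?_⟩
  obtain ⟨i, rfl⟩ : ∃ i', i = i' + 1 := ⟨i - 1, by omega⟩
  exact h i (by omega)

lemma exists_run_eq_runLen {n : ℕ} (hn : 1 ≤ n) (x : ℝ) : 1 ≤ runLen n x ∧
    ∃ j, j + runLen n x ≤ n ∧ ∀ i < runLen n x, lurothD (j + i + 1) x = lurothD (j + 1) x := by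
  obtain ⟨h1, j, hj, h⟩ := Nat.sSup_mem (s := {k : ℕ | 1 ≤ k ∧ ∃ j : ℕ, j + k ≤ n ∧
    ∀ i : ℕ, 1 ≤ i → i ≤ k → lurothD (j + i) x = lurothD (j + 1) x})
    ⟨1, le_rfl, 0, by omega, fun i h1 h2 => by rw [show i = 1 by omega]⟩ (bddAbove_runs n x)
  exact ⟨h1, j, hj, fun i hi => h (i + 1) (by omega) hi⟩

lemma runLen_le (n : ℕ) (x : ℝ) : runLen n x ≤ n :=
  csSup_le' fun k hk => by obtain ⟨-, j, hj, -⟩ := hk; omega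

lemma runLen_div_mem (n : ℕ) (x : ℝ) : (runLen n x : ℝ) / n ∈ Icc (0 : ℝ) 1 :=
  ⟨by positivity, div_le_one_of_le₀ (by exact_mod_cast runLen_le n x) (by positivity)⟩

/-- Points of `(0, 1]` having, for infinitely many lengths `k`, a run of `k` equal digits that
starts after at most `k / u` digits. -/
def longRunSet (u : ℝ) : Set ℝ :=
  {x | x ∈ Ioc (0 : ℝ) 1 ∧ ∀ K : ℕ, ∃ j k : ℕ, K ≤ k ∧ u * j < k ∧
    ∀ i < k, lurothD (j + i + 1) x = lurothD (j + 1) x}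

lemma Eab_subset_longRunSet {β u : ℝ} (hu : 0 < u) (huβ : u / (1 + u) < β) :
    Eab 0 β ⊆ longRunSet u := by
  rintro x ⟨hx, -, hlim⟩
  refine ⟨hx, fun K => ?_⟩
  rw [← hlim] at huβ
  have hc0 : 0 < u / (1 + u) := by positivity
  have hfr := frequently_lt_of_lt_limsup
    (isCoboundedUnder_le_of_le atTop (x := 0) fun n => (runLen_div_mem n x).1) huβ
  obtain ⟨n, hn, hlt⟩ := (hfr.and_eventually
    (eventually_ge_atTop (⌈K / (u / (1 + u))⌉₊ + 1))).exists
  obtain ⟨h1, j, hj, hrun⟩ := exists_run_eq_runLen (n := n) (by omega) x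
  have hn0 : (0 : ℝ) < n := by exact_mod_cast (by omega : 0 < n)
  rw [lt_div_iff₀ hn0] at hn
  refine ⟨j, runLen n x, ?_, ?_, hrun⟩
  · have h2 : (K : ℝ) / (u / (1 + u)) ≤ n := (Nat.le_ceil _).trans (by exact_mod_cast (by omega))
    rw [div_le_iff₀ hc0] at h2
    have : (K : ℝ) < runLen n x := by linarith
    exact_mod_cast this.le
  · have h3 : (j : ℝ) + runLen n x ≤ n := by exact_mod_cast hj
    rw [div_mul_eq_mul_div, div_lt_iff₀ (by positivity)] at hn
    nlinarith

lemma ENNReal.tsum_fin_prod (g : ℕ → ENNReal) (n : ℕ) :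
    ∑' w : Fin n → ℕ, ∏ i, g (w i) = (∑' t, g t) ^ n := by
  induction n with
  | zero => simp
  | succ n ih =>
    rw [← (Fin.consEquiv (fun _ : Fin (n + 1) => ℕ)).tsum_eq, ENNReal.tsum_prod', pow_succ', ← ih,
      ← ENNReal.tsum_mul_right]
    refine tsum_congr fun a => ?_
    rw [← ENNReal.tsum_mul_left]
    refine tsum_congr fun w => ?_
    simp [Fin.consEquiv, Fin.prod_univ_succ]

lemma hausdorffMeasure_longRunSet_ne_top {s u : ℝ} (hs : 0 < s) (hu : 0 < u)
    (hP : (∑' t, ENNReal.ofReal (lurothRho t) ^ s) * ((2⁻¹ : ENNReal) ^ s) ^ u < 1) :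
    μH[s] (longRunSet u) ≠ ⊤ := by
  set g : ℕ → ENNReal := fun t => ENNReal.ofReal (lurothRho t) ^ s with hg
  set P := ∑' t, g t with hPdef
  set h : ENNReal := (2⁻¹ : ENNReal) ^ s with hh
  have hhalf : ∀ t, ENNReal.ofReal (lurothRho t) ≤ 2⁻¹ := fun t => by
    refine (ENNReal.ofReal_le_ofReal (lurothRho_le_half t)).trans ?_
    rw [one_div, ENNReal.ofReal_inv_of_pos (by norm_num)]
    simp
  have hgh : ∀ t, g t ≤ h := fun t => ENNReal.rpow_le_rpow (hhalf t) hs.le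
  have hh0 : h ≠ 0 := by simp [hh, ENNReal.rpow_eq_zero_iff]
  have hh1 : h < 1 := ENNReal.rpow_lt_one (by simp) hs
  have hhtop : h ≠ ⊤ := (hh1.trans ENNReal.one_lt_top).ne
  have hPtop : P ≠ ⊤ := by
    intro hPt
    rw [hPt, ENNReal.top_mul] at hP
    · simp at hP
    · exact (ENNReal.rpow_pos (pos_iff_ne_zero.2 hh0) hhtop).ne'
  let word : (p : Σ p : ℕ × ℕ, (Fin p.1 → ℕ) × ℕ) → ℕ → ℕ := fun p i =>
    if hi : i < p.1.1 then p.2.1 ⟨i, hi⟩ else p.2.2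
  let len : (p : Σ p : ℕ × ℕ, (Fin p.1 → ℕ) × ℕ) → ℕ := fun p => ⌊u * p.1.1⌋₊ + p.1.2 + 1
  let cov : ℕ → (p : Σ p : ℕ × ℕ, (Fin p.1 → ℕ) × ℕ) → Set ℝ := fun K p =>
    if K ≤ len p then lurothCyl (p.1.1 + len p) (word p) else ∅
  have hprod : ∀ p, ∏ i ∈ Finset.range (p.1.1 + len p), ENNReal.ofReal (lurothRho (word p i)) =
      (∏ i, ENNReal.ofReal (lurothRho (p.2.1 i))) * ENNReal.ofReal (lurothRho p.2.2) ^ len p := by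
    rintro ⟨⟨j, i⟩, w, t⟩
    rw [Finset.prod_range_add, Finset.prod_range]
    congr 1
    · exact Finset.prod_congr rfl fun a _ => by simp [word]
    · simp [word]
  have hdiam : ∀ K p, Metric.ediam (cov K p) ≤
      (∏ i, ENNReal.ofReal (lurothRho (p.2.1 i))) * ENNReal.ofReal (lurothRho p.2.2) ^ len p := by
    intro K p
    by_cases hK : K ≤ len p
    · simp only [cov, if_pos hK]
      refine (ediam_lurothCyl_le _ _).trans ?_
      rw [ENNReal.ofReal_prod_of_nonneg fun i _ => (lurothRho_pos _).le, hprod]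
    · simp [cov, if_neg hK]
  have hle := Measure.hausdorffMeasure_le_liminf_tsum (ι := fun _ : ℕ =>
      Σ p : ℕ × ℕ, (Fin p.1 → ℕ) × ℕ) s (longRunSet u) (l := atTop)
    (fun K : ℕ => (2⁻¹ : ENNReal) ^ K) (ENNReal.tendsto_pow_atTop_nhds_zero_of_lt_one (by simp)) cov
    (Eventually.of_forall fun K p => by
      by_cases hK : K ≤ len p
      · refine (hdiam K p).trans ?_
        calc _ ≤ 1 * (2⁻¹ : ENNReal) ^ len p := by
              gcongr
              · exact Finset.prod_le_one' fun i _ => (hhalf _).trans (by simp)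
              · exact hhalf _
          _ ≤ _ := by
              rw [one_mul]
              exact pow_le_pow_right_of_le_one' (by simp) hK
      · simp [cov, if_neg hK])
    (Eventually.of_forall fun K x hx => by
      obtain ⟨hx1, hx2⟩ := hx
      obtain ⟨j, k, hKk, hjk, hrun⟩ := hx2 K
      have hfl : ⌊u * j⌋₊ < k := (Nat.floor_lt (by positivity)).2 hjk
      choose d hd using exists_lurothD_eq hx1
      have hlen : len ⟨(j, k - (⌊u * j⌋₊ + 1)), (fun i => d i, d j)⟩ = k := by
        simp only [len]; omega
      refine mem_iUnion.2 ⟨⟨(j, k - (⌊u * j⌋₊ + 1)), (fun i => d i, d j)⟩, ?_⟩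
      simp only [cov, hlen, if_pos hKk]
      refine ⟨hx1, fun i hi => ?_⟩
      by_cases hij : i < j
      · simp [word, hij, hd]
      · simp only [word, hij, dite_false]
        rw [← hd j]
        obtain ⟨i, rfl⟩ := Nat.exists_eq_add_of_le (not_lt.1 hij)
        exact hrun i (by omega))
  refine ne_top_of_le_ne_top ?_ hle
  have hbound : ∀ K, ∑' p, Metric.ediam (cov K p) ^ s ≤
      (∑' j : ℕ, (P * h ^ u) ^ j) * (∑' i : ℕ, h ^ i) * (P * h⁻¹) := by
    intro K
    calc _ ≤ ∑' p : (Σ p : ℕ × ℕ, (Fin p.1 → ℕ) × ℕ),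
          (∏ i, g (p.2.1 i)) * (g p.2.2 * h ^ (⌊u * p.1.1⌋₊ + p.1.2)) := by
          refine ENNReal.tsum_le_tsum fun p => ?_
          refine (ENNReal.rpow_le_rpow (hdiam K p) hs.le).trans ?_
          rw [ENNReal.mul_rpow_of_nonneg _ _ hs.le, ENNReal.prod_rpow_of_nonneg hs.le,
            ← ENNReal.rpow_natCast, ← ENNReal.rpow_mul, mul_comm (_ : ℝ) s, ENNReal.rpow_mul,
            ENNReal.rpow_natCast]
          refine mul_le_mul' le_rfl ?_
          simp only [len]
          rw [pow_succ']
          exact mul_le_mul' le_rfl (pow_le_pow_left' (hgh _) _)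
      _ = ∑' p : ℕ × ℕ, P ^ p.1 * (P * h ^ (⌊u * p.1⌋₊ + p.2)) := by
          rw [ENNReal.tsum_sigma']
          refine tsum_congr fun p => ?_
          rw [ENNReal.tsum_prod']
          rw [← ENNReal.tsum_fin_prod, ← ENNReal.tsum_mul_right, ← ENNReal.tsum_mul_right]
          exact tsum_congr fun w =>
            ENNReal.tsum_mul_left (a := ∏ i, g (w i)) (f := fun t => g t * h ^ (⌊u * p.1⌋₊ + p.2))
      _ ≤ ∑' p : ℕ × ℕ, (P * h ^ u) ^ p.1 * (h ^ p.2 * (P * h⁻¹)) := by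
          refine ENNReal.tsum_le_tsum fun p => ?_
          have h1 : h ^ ⌊u * p.1⌋₊ ≤ (h ^ u) ^ p.1 * h⁻¹ := by
            rw [← ENNReal.rpow_natCast h, ← ENNReal.rpow_natCast (h ^ u), ← ENNReal.rpow_mul h,
              ← ENNReal.rpow_neg_one h, ← ENNReal.rpow_add _ _ hh0 hhtop]
            exact ENNReal.rpow_le_rpow_of_exponent_ge hh1.le (by
              have := Nat.lt_floor_add_one (u * p.1); linarith)
          calc _ = P ^ p.1 * P * h ^ p.2 * h ^ ⌊u * p.1⌋₊ := by rw [pow_add]; ring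
            _ ≤ P ^ p.1 * P * h ^ p.2 * ((h ^ u) ^ p.1 * h⁻¹) := by gcongr
            _ = _ := by rw [mul_pow]; ring
      _ = _ := by
          rw [ENNReal.tsum_prod']
          simp_rw [ENNReal.tsum_mul_left, ENNReal.tsum_mul_right]
          ring
  refine ne_top_of_le_ne_top ?_ (liminf_le_of_le (by isBoundedDefault)
    fun b hb => (hb.exists.choose_spec).trans (hbound _))
  refine ENNReal.mul_ne_top (ENNReal.mul_ne_top ?_ ?_)
    (ENNReal.mul_ne_top hPtop (ENNReal.inv_ne_top.2 hh0))
  · rw [ENNReal.tsum_geometric]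
    exact ENNReal.inv_ne_top.2 (tsub_pos_of_lt hP).ne'
  · rw [ENNReal.tsum_geometric]
    exact ENNReal.inv_ne_top.2 (tsub_pos_of_lt hh1).ne'

lemma lurothF_term_eq (u s : ℝ) (t : ℕ) :
    (1 / (2 ^ u * ((t : ℝ) + 2) * ((t : ℝ) + 1))) ^ s = (2 ^ (-u) * lurothRho t) ^ s := by
  congr 1
  unfold lurothRho
  rw [Real.rpow_neg (by norm_num)]
  field_simp

lemma two_rpow_neg_mul_lurothRho_pos (u : ℝ) (t : ℕ) : 0 < (2 : ℝ) ^ (-u) * lurothRho t :=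
  mul_pos (by positivity) (lurothRho_pos t)

lemma two_rpow_neg_mul_lurothRho_lt_one {u : ℝ} (hu : 0 ≤ u) (t : ℕ) :
    (2 : ℝ) ^ (-u) * lurothRho t < 1 := by
  have h1 : (2 : ℝ) ^ (-u) ≤ 1 := Real.rpow_le_one_of_one_le_of_nonpos (by norm_num) (by linarith)
  have h2 := lurothRho_le_half t
  have h3 := lurothRho_pos t
  nlinarith

lemma exists_lt_tsum_mul_lt_one {u S s : ℝ} (hu : 0 < u) (hS0 : 0 < S) (hS : lurothF u S = 1)
    (hs : S < s) :
    ∃ u', 0 < u' ∧ u' < u ∧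
      (∑' t, ENNReal.ofReal (lurothRho t) ^ s) * ((2⁻¹ : ENNReal) ^ s) ^ u' < 1 := by
  have hs0 : 0 < s := hS0.trans hs
  simp only [lurothF, lurothF_term_eq] at hS
  have hsumS : Summable fun t => ((2 : ℝ) ^ (-u) * lurothRho t) ^ S := by
    by_contra h
    rw [tsum_eq_zero_of_not_summable h] at hS
    norm_num at hS
  have hlt : ∀ t, ((2 : ℝ) ^ (-u) * lurothRho t) ^ s < (2 ^ (-u) * lurothRho t) ^ S := fun t =>
    Real.rpow_lt_rpow_of_exponent_gt (two_rpow_neg_mul_lurothRho_pos u t)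
      (two_rpow_neg_mul_lurothRho_lt_one hu.le t) hs
  have hsums : Summable fun t => ((2 : ℝ) ^ (-u) * lurothRho t) ^ s :=
    Summable.of_nonneg_of_le (fun t => (Real.rpow_pos_of_pos
      (two_rpow_neg_mul_lurothRho_pos u t) s).le) (fun t => (hlt t).le) hsumS
  have h1 : ∑' t, ((2 : ℝ) ^ (-u) * lurothRho t) ^ s < 1 := by
    rw [← hS]
    exact Summable.tsum_lt_tsum (fun t => (hlt t).le) (hlt 0) hsums hsumS
  have hsplit : ∀ t, ((2 : ℝ) ^ (-u) * lurothRho t) ^ s = (2 ^ (-u)) ^ s * lurothRho t ^ s :=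
    fun t => Real.mul_rpow (by positivity) (lurothRho_pos t).le
  simp_rw [hsplit] at h1 hsums
  have hsumr : Summable fun t => lurothRho t ^ s :=
    (summable_mul_left_iff (by positivity)).1 hsums
  rw [tsum_mul_left] at h1
  have hcont : Continuous fun v : ℝ => ((2 : ℝ) ^ (-v)) ^ s * ∑' t, lurothRho t ^ s := by
    have : Continuous fun v : ℝ => (2 : ℝ) ^ (-v) :=
      Real.continuous_const_rpow (by norm_num) |>.comp continuous_neg
    exact (this.rpow_const fun v => Or.inr hs0.le).mul continuous_const
  have hev := (hcont.tendsto u).eventually_lt_const h1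
  obtain ⟨u', h2, h3⟩ := ((hev.filter_mono (nhdsWithin_le_nhds (s := Iio u))).and
    (Ioo_mem_nhdsLT hu)).exists
  refine ⟨u', h3.1, h3.2, ?_⟩
  have h4 : ∀ t, ENNReal.ofReal (lurothRho t) ^ s = ENNReal.ofReal (lurothRho t ^ s) := fun t =>
    ENNReal.ofReal_rpow_of_pos (lurothRho_pos t)
  have h5 : ((2⁻¹ : ENNReal) ^ s) ^ u' = ENNReal.ofReal (((2 : ℝ) ^ (-u')) ^ s) := by
    rw [← ENNReal.ofReal_rpow_of_pos (by positivity), ← ENNReal.ofReal_rpow_of_pos (by norm_num),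
      ← ENNReal.rpow_mul, ← ENNReal.rpow_mul, ENNReal.ofReal_ofNat, ENNReal.inv_rpow,
      ← ENNReal.rpow_neg]
    congr 1
    ring
  simp_rw [h4]
  rw [← ENNReal.ofReal_tsum_of_nonneg (fun t => (Real.rpow_pos_of_pos (lurothRho_pos t) s).le) hsumr,
    h5, mul_comm, ← ENNReal.ofReal_mul (by positivity), ← ENNReal.ofReal_one]
  exact (ENNReal.ofReal_lt_ofReal_iff one_pos).2 h2

lemma summable_lurothRho_rpow {s : ℝ} (hs : 1 / 2 < s) : Summable fun t => lurothRho t ^ s := by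
  have h : Summable fun t : ℕ => 1 / ((t : ℝ) + 1) ^ (2 * s) := by
    have := (summable_nat_add_iff 1).2 (Real.summable_one_div_nat_rpow.2 (by linarith : 1 < 2 * s))
    simpa using this
  refine Summable.of_nonneg_of_le (fun t => (Real.rpow_pos_of_pos (lurothRho_pos t) s).le)
    (fun t => ?_) h
  have ht : (0 : ℝ) ≤ t := t.cast_nonneg
  rw [Real.rpow_mul (by positivity), ← Real.one_rpow s, ← Real.div_rpow (by norm_num) (by positivity),
    Real.one_rpow]
  refine Real.rpow_le_rpow (lurothRho_pos t).le ?_ (by linarith)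
  unfold lurothRho
  apply one_div_le_one_div_of_le (by positivity)
  norm_num
  nlinarith

lemma exists_one_lt_sum {u S s : ℝ} (hu : 0 < u) (hS : lurothF u S = 1) (hs : 1 / 2 < s)
    (hsS : s < S) : ∃ M : ℕ, 1 < ∑ t : Fin M, ((2 : ℝ) ^ (-u) * lurothRho t) ^ s := by
  simp only [lurothF, lurothF_term_eq] at hS
  have hsums : ∀ {r : ℝ}, 1 / 2 < r → Summable fun t => ((2 : ℝ) ^ (-u) * lurothRho t) ^ r := by
    intro r hr
    refine ((summable_lurothRho_rpow hr).mul_left ((2 ^ (-u)) ^ r)).congr fun t => ?_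
    exact (Real.mul_rpow (by positivity) (lurothRho_pos t).le).symm
  have hlt : ∀ t, ((2 : ℝ) ^ (-u) * lurothRho t) ^ S < (2 ^ (-u) * lurothRho t) ^ s := fun t =>
    Real.rpow_lt_rpow_of_exponent_gt (two_rpow_neg_mul_lurothRho_pos u t)
      (two_rpow_neg_mul_lurothRho_lt_one hu.le t) hsS
  have h1 : 1 < ∑' t, ((2 : ℝ) ^ (-u) * lurothRho t) ^ s := by
    rw [← hS]
    exact Summable.tsum_lt_tsum (fun t => (hlt t).le) (hlt 0) (hsums (hs.trans hsS)) (hsums hs)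
  obtain ⟨M, hM⟩ := ((hsums hs).hasSum.tendsto_sum_nat.eventually_const_lt h1).exists
  exact ⟨M, by rwa [Finset.sum_range] at hM⟩

/-- The `n`-th term of the Lüroth series with digits `ω i + 2`. -/
noncomputable def lurothTerm (n : ℕ) (ω : ℕ → ℕ) : ℝ :=
  (∏ i ∈ Finset.range n, lurothRho (ω i)) * (1 / ((ω n : ℝ) + 2))

/-- The point of `(0, 1]` with Lüroth digits `ω i + 2`. -/
noncomputable def lurothPoint (ω : ℕ → ℕ) : ℝ := ∑' n, lurothTerm n ω

lemma prod_lurothRho_pos (ω : ℕ → ℕ) (n : ℕ) : 0 < ∏ i ∈ Finset.range n, lurothRho (ω i) :=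
  Finset.prod_pos fun i _ => lurothRho_pos (ω i)

lemma prod_lurothRho_le (ω : ℕ → ℕ) (n : ℕ) :
    ∏ i ∈ Finset.range n, lurothRho (ω i) ≤ (1 / 2) ^ n := by
  refine (Finset.prod_le_prod (fun i _ => (lurothRho_pos _).le)
    (fun i _ => lurothRho_le_half (ω i))).trans ?_
  simp

lemma lurothTerm_pos (n : ℕ) (ω : ℕ → ℕ) : 0 < lurothTerm n ω :=
  mul_pos (prod_lurothRho_pos ω n) (by positivity)

lemma lurothTerm_le (n : ℕ) (ω : ℕ → ℕ) : lurothTerm n ω ≤ (1 / 2) ^ n := by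
  unfold lurothTerm
  have h1 := prod_lurothRho_le ω n
  have h2 : 1 / ((ω n : ℝ) + 2) ≤ 1 := by
    rw [div_le_one (by positivity)]
    have : (0 : ℝ) ≤ ω n := (ω n).cast_nonneg
    linarith
  calc _ ≤ (1 / 2 : ℝ) ^ n * 1 := by gcongr
    _ = _ := mul_one _

lemma summable_lurothTerm (ω : ℕ → ℕ) : Summable fun n => lurothTerm n ω :=
  Summable.of_nonneg_of_le (fun n => (lurothTerm_pos n ω).le) (fun n => lurothTerm_le n ω)
    summable_geometric_two

lemma lurothTerm_succ (n : ℕ) (ω : ℕ → ℕ) :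
    lurothTerm (n + 1) ω = lurothRho (ω 0) * lurothTerm n (fun i => ω (i + 1)) := by
  unfold lurothTerm
  rw [Finset.prod_range_succ']
  ring

lemma lurothPoint_eq_branch (ω : ℕ → ℕ) :
    lurothPoint ω = lurothBranch (ω 0) (lurothPoint fun i => ω (i + 1)) := by
  unfold lurothPoint lurothBranch
  rw [(summable_lurothTerm ω).tsum_eq_zero_add]
  simp_rw [lurothTerm_succ, tsum_mul_left]
  simp [lurothTerm]

lemma sum_lurothTerm_le_one (n : ℕ) (ω : ℕ → ℕ) :
    ∑ i ∈ Finset.range n, lurothTerm i ω ≤ 1 := by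
  induction n generalizing ω with
  | zero => simp
  | succ n ih =>
    rw [Finset.sum_range_succ']
    simp_rw [lurothTerm_succ, ← Finset.mul_sum]
    have h := lurothBranch_le (t := ω 0) (ih fun i => ω (i + 1))
    have h2 : 1 / ((ω 0 : ℝ) + 1) ≤ 1 := by
      rw [div_le_one (by positivity)]
      have : (0 : ℝ) ≤ ω 0 := (ω 0).cast_nonneg
      linarith
    unfold lurothBranch at h
    simp only [lurothTerm, Finset.range_zero, Finset.prod_empty, one_mul] at h ⊢
    linarith

lemma lurothPoint_mem (ω : ℕ → ℕ) : lurothPoint ω ∈ Ioc (0 : ℝ) 1 :=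
  ⟨(summable_lurothTerm ω).tsum_pos (fun n => (lurothTerm_pos n ω).le) 0 (lurothTerm_pos 0 ω),
    (summable_lurothTerm ω).tsum_le_of_sum_range_le fun n => sum_lurothTerm_le_one n ω⟩

lemma lurothD_lurothPoint (n : ℕ) (ω : ℕ → ℕ) : lurothD (n + 1) (lurothPoint ω) = ω n + 2 := by
  induction n generalizing ω with
  | zero =>
    rw [lurothPoint_eq_branch, lurothD_one_lurothBranch (lurothPoint_mem _)]
  | succ n ih =>
    rw [lurothD_succ_succ, lurothPoint_eq_branch, lurothT_lurothBranch (lurothPoint_mem _), ih]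

lemma lurothPoint_sub {ω ω' : ℕ → ℕ} {n : ℕ} (h : ∀ i < n, ω i = ω' i) :
    lurothPoint ω - lurothPoint ω' = (∏ i ∈ Finset.range n, lurothRho (ω i)) *
      (lurothPoint (fun i => ω (i + n)) - lurothPoint (fun i => ω' (i + n))) := by
  induction n generalizing ω ω' with
  | zero => simp
  | succ n ih =>
    rw [lurothPoint_eq_branch ω, lurothPoint_eq_branch ω', ← h 0 (by omega),
      Finset.prod_range_succ']
    have := ih (ω := fun i => ω (i + 1)) (ω' := fun i => ω' (i + 1)) fun i hi => h _ (by omega)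
    unfold lurothBranch
    rw [show ∀ a b c d : ℝ, a + b * c - (a + b * d) = b * (c - d) by intros; ring, this]
    simp only [show ∀ i, i + n + 1 = i + (n + 1) by intros; ring]
    ring

lemma lurothPoint_gap {M : ℕ} {ω ω' : ℕ → ℕ} (hω : ∀ i, ω i < M) (h : ω 0 < ω' 0) :
    1 / ((M : ℝ) + 2) ^ 3 ≤ lurothPoint ω - lurothPoint ω' := by
  have h1 := lurothBranch_le (t := ω' 0) (lurothPoint_mem fun i => ω' (i + 1)).2
  rw [← lurothPoint_eq_branch] at h1
  have h2 : 1 / ((ω' 0 : ℝ) + 1) ≤ 1 / ((ω 0 : ℝ) + 2) := by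
    apply one_div_le_one_div_of_le (by positivity)
    have : (ω 0 : ℝ) + 1 ≤ ω' 0 := by exact_mod_cast h
    linarith
  have hb : ∀ i, (ω i : ℝ) ≤ M := fun i => by exact_mod_cast (hω i).le
  have h3 : 1 / ((M : ℝ) + 2) ≤ lurothPoint fun i => ω (i + 1) := by
    rw [lurothPoint_eq_branch]
    refine le_trans ?_ (lt_lurothBranch (lurothPoint_mem _).1).le
    have := hb (0 + 1)
    gcongr
  have h4 : 1 / ((M : ℝ) + 2) ^ 2 ≤ lurothRho (ω 0) := by
    unfold lurothRho
    have := hb 0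
    have h0 : (0 : ℝ) ≤ ω 0 := (ω 0).cast_nonneg
    apply one_div_le_one_div_of_le (by positivity)
    nlinarith
  have h5 : 1 / ((M : ℝ) + 2) ^ 3 ≤ lurothRho (ω 0) * lurothPoint fun i => ω (i + 1) := by
    calc _ = 1 / ((M : ℝ) + 2) ^ 2 * (1 / ((M : ℝ) + 2)) := by field_simp
      _ ≤ _ := by gcongr; exact (lurothRho_pos _).le
  rw [lurothPoint_eq_branch ω]
  unfold lurothBranch
  linarith

lemma lurothPoint_dist {M n : ℕ} {ω ω' : ℕ → ℕ} (hω : ∀ i, ω i < M) (hω' : ∀ i, ω' i < M)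
    (h : ∀ i < n, ω i = ω' i) (hn : ω n ≠ ω' n) :
    (∏ i ∈ Finset.range n, lurothRho (ω i)) * (1 / ((M : ℝ) + 2) ^ 3) ≤
      dist (lurothPoint ω) (lurothPoint ω') := by
  rw [Real.dist_eq, lurothPoint_sub h, abs_mul, abs_of_pos (prod_lurothRho_pos ω n)]
  refine mul_le_mul_of_nonneg_left ?_ (prod_lurothRho_pos ω n).le
  rcases lt_or_gt_of_ne hn with hlt | hlt
  · exact (lurothPoint_gap (ω := fun i => ω (i + n)) (ω' := fun i => ω' (i + n))
      (fun i => hω _) (by simpa using hlt)).trans (le_abs_self _)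
  · rw [abs_sub_comm]
    exact (lurothPoint_gap (ω := fun i => ω' (i + n)) (ω' := fun i => ω (i + n))
      (fun i => hω' _) (by simpa using hlt)).trans (le_abs_self _)

lemma continuous_lurothPoint : Continuous lurothPoint := by
  refine continuous_tsum (u := fun n => (1 / 2 : ℝ) ^ n) (fun n => ?_) summable_geometric_two
    fun n ω => ?_
  · have h : ∀ (g : ℕ → ℝ) (i : ℕ), Continuous fun ω : ℕ → ℕ => g (ω i) := fun g i =>
      continuous_of_discreteTopology.comp (continuous_apply i)
    exact (continuous_finsetProd _ fun i _ => h lurothRho i).mul (h (fun t => 1 / ((t : ℝ) + 2)) n)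
  · rw [Real.norm_of_nonneg (lurothTerm_pos n ω).le]
    exact lurothTerm_le n ω

/-- Mass distribution principle for sets of points with bounded Lüroth digits. -/
lemma le_dimH_of_measure_cylinder_le {X : Type*} [MeasurableSpace X] {μ : Measure X}
    [IsProbabilityMeasure μ] {φ : X → ℕ → ℕ} (hφ : Measurable φ) {M : ℕ}
    (hM : ∀ y i, φ y i < M) {s C : ℝ} (hs : 0 < s)
    (hμ : ∀ y n, μ {y' | ∀ i < n, φ y' i = φ y i} ≤
      ENNReal.ofReal (C * (∏ i ∈ Finset.range n, lurothRho (φ y i)) ^ s))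
    {E : Set ℝ} (hE : ∀ y, lurothPoint (φ y) ∈ E) : ENNReal.ofReal s ≤ dimH E := by
  set κ : ℝ := 1 / ((M : ℝ) + 2) ^ 3 with hκ
  have hκ0 : 0 < κ := by positivity
  have hC : 0 ≤ C := by
    by_contra! hC
    have y : X := (nonempty_of_isProbabilityMeasure μ).some
    have := hμ y 0
    simp [ENNReal.ofReal_of_nonpos hC.le] at this
  have hmeas : Measurable fun y => lurothPoint (φ y) := continuous_lurothPoint.measurable.comp hφ
  set D : ENNReal := ENNReal.ofReal C * ENNReal.ofReal κ⁻¹ ^ s + 1 with hD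
  have hD0 : D ≠ 0 := by simp [hD]
  have hDtop : D ≠ ⊤ := by
    simp [hD, ENNReal.mul_eq_top, ENNReal.rpow_eq_top_iff, hs.le]
  have hpre : ∀ A : Set ℝ, μ {y | lurothPoint (φ y) ∈ A} ≤ D * Metric.ediam A ^ s := by
    intro A
    by_cases hex : ∃ n, ∃ y y', lurothPoint (φ y) ∈ A ∧ lurothPoint (φ y') ∈ A ∧ φ y n ≠ φ y' n
    · classical
      obtain ⟨y, y', hy, hy', hne⟩ := Nat.find_spec hex
      have hmin : ∀ i < Nat.find hex, ∀ z z', lurothPoint (φ z) ∈ A → lurothPoint (φ z') ∈ A →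
          φ z i = φ z' i := by
        intro i hi z z' hz hz'
        by_contra hc
        exact Nat.find_min hex hi ⟨z, z', hz, hz', hc⟩
      generalize Nat.find hex = n at hne hmin
      have hd := lurothPoint_dist (hM y) (hM y') (fun i hi => hmin i hi _ _ hy hy') hne
      set Q := ∏ i ∈ Finset.range n, lurothRho (φ y i) with hQ
      have hQ0 : 0 < Q := prod_lurothRho_pos _ _
      have hQd : ENNReal.ofReal Q ≤ ENNReal.ofReal κ⁻¹ * Metric.ediam A := by
        calc ENNReal.ofReal Q ≤ ENNReal.ofReal (κ⁻¹ * dist (lurothPoint (φ y))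
              (lurothPoint (φ y'))) := by
              refine ENNReal.ofReal_le_ofReal ?_
              rw [inv_mul_eq_div, le_div_iff₀ hκ0]
              exact hd
          _ = ENNReal.ofReal κ⁻¹ * edist (lurothPoint (φ y)) (lurothPoint (φ y')) := by
              rw [ENNReal.ofReal_mul (by positivity), edist_dist]
          _ ≤ _ := by gcongr; exact Metric.edist_le_ediam_of_mem hy hy'
      calc _ ≤ μ {y' | ∀ i < n, φ y' i = φ y i} :=
            measure_mono fun z hz i hi => hmin i hi _ _ hz hy
        _ ≤ ENNReal.ofReal (C * Q ^ s) := hμ y n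
        _ = ENNReal.ofReal C * ENNReal.ofReal Q ^ s := by
            rw [ENNReal.ofReal_mul hC, ENNReal.ofReal_rpow_of_pos hQ0]
        _ ≤ ENNReal.ofReal C * (ENNReal.ofReal κ⁻¹ * Metric.ediam A) ^ s := by gcongr
        _ = ENNReal.ofReal C * ENNReal.ofReal κ⁻¹ ^ s * Metric.ediam A ^ s := by
            rw [ENNReal.mul_rpow_of_nonneg _ _ hs.le, mul_assoc]
        _ ≤ _ := by gcongr; exact le_self_add
    · push Not at hex
      rcases eq_empty_or_nonempty {y | lurothPoint (φ y) ∈ A} with he | ⟨y, hy⟩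
      · rw [he]; simp
      · have hle : ∀ n : ℕ, μ {y | lurothPoint (φ y) ∈ A} ≤
            ENNReal.ofReal (C * ((1 / 2 : ℝ) ^ s) ^ n) := by
          intro n
          have hsub : {y | lurothPoint (φ y) ∈ A} ⊆ {y' | ∀ i < n, φ y' i = φ y i} :=
            fun z hz i _ => hex i z y hz hy
          refine (measure_mono hsub).trans ((hμ y n).trans ?_)
          refine ENNReal.ofReal_le_ofReal (mul_le_mul_of_nonneg_left ?_ hC)
          rw [← Real.rpow_natCast, ← Real.rpow_mul (by norm_num), mul_comm s,
            Real.rpow_mul (by norm_num), Real.rpow_natCast]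
          exact Real.rpow_le_rpow (prod_lurothRho_pos _ _).le (prod_lurothRho_le _ _) hs.le
        have hlim : Tendsto (fun n : ℕ => ENNReal.ofReal (C * ((1 / 2 : ℝ) ^ s) ^ n)) atTop
            (nhds 0) := by
          rw [← ENNReal.ofReal_zero, ← mul_zero C]
          exact ENNReal.tendsto_ofReal ((tendsto_pow_atTop_nhds_zero_of_lt_one (by positivity)
            (Real.rpow_lt_one (by norm_num) (by norm_num) hs)).const_mul C)
        exact (ge_of_tendsto' hlim hle).trans zero_le
  have hle : D⁻¹ • μ.map (fun y => lurothPoint (φ y)) ≤ μH[s] := by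
    refine Measure.le_hausdorffMeasure s _ 1 one_pos fun A _ => ?_
    calc _ ≤ (D⁻¹ • μ.map (fun y => lurothPoint (φ y))) (closure A) := measure_mono subset_closure
      _ = D⁻¹ * μ {y | lurothPoint (φ y) ∈ closure A} := by
          rw [Measure.smul_apply, Measure.map_apply hmeas isClosed_closure.measurableSet]
          rfl
      _ ≤ D⁻¹ * (D * Metric.ediam (closure A) ^ s) := by gcongr; exact hpre _
      _ = Metric.ediam A ^ s := by
          rw [← mul_assoc, ENNReal.inv_mul_cancel hD0 hDtop, one_mul, Metric.ediam_closure]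
  have hne : μH[s] E ≠ 0 := by
    have h1 : (1 : ENNReal) ≤ μ.map (fun y => lurothPoint (φ y)) E := by
      refine le_trans ?_ (Measure.le_map_apply hmeas.aemeasurable E)
      rw [show (fun y => lurothPoint (φ y)) ⁻¹' E = univ from eq_univ_of_forall hE, measure_univ]
    have h2 : D⁻¹ ≤ μH[s] E := by
      refine le_trans ?_ (hle E)
      rw [Measure.smul_apply, smul_eq_mul]
      calc D⁻¹ = D⁻¹ * 1 := (mul_one _).symm
        _ ≤ _ := by gcongr
    exact fun h0 => (ENNReal.inv_ne_zero.2 hDtop) (le_antisymm (h0 ▸ h2) zero_le)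
  have := le_dimH_of_hausdorffMeasure_ne_zero (d := s.toNNReal) (s := E)
    (by rwa [Real.coe_toNNReal s hs.le])
  exact this

lemma StrictMono.exists_le_lt_succ {e : ℕ → ℕ} (he : StrictMono e) {n : ℕ} (hn : e 0 ≤ n) :
    ∃ k, e k ≤ n ∧ n < e (k + 1) := by
  induction n, hn using Nat.le_induction with
  | base => exact ⟨0, le_rfl, he (by omega)⟩
  | succ n _ ih =>
    obtain ⟨k, h1, h2⟩ := ih
    have := he (show k + 1 < k + 1 + 1 by omega)
    by_cases h : n + 1 < e (k + 1)
    · exact ⟨k, by omega, h⟩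
    · exact ⟨k + 1, by omega, by omega⟩

/-- The end of the `k`-th forced block: `F k` free digits and `⌊u * F k⌋₊` forced digits occur
before it. -/
noncomputable def blockEnd (F : ℕ → ℕ) (u : ℝ) (k : ℕ) : ℕ := F k + ⌊u * F k⌋₊

/-- The start of the `(k + 1)`-st forced block. -/
noncomputable def blockStart (F : ℕ → ℕ) (u : ℝ) (k : ℕ) : ℕ := F (k + 1) + ⌊u * F k⌋₊

/-- The index `i` lies in one of the forced blocks. -/
def IsForced (F : ℕ → ℕ) (u : ℝ) (i : ℕ) : Prop :=
  ∃ k, blockStart F u k ≤ i ∧ i < blockEnd F u (k + 1)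

open scoped Classical in
/-- The number of indices below `n` outside the forced blocks. -/
noncomputable def freeCount (F : ℕ → ℕ) (u : ℝ) (n : ℕ) : ℕ :=
  Nat.count (fun i => ¬ IsForced F u i) n

section Blocks

variable {F : ℕ → ℕ} {u : ℝ}

lemma floor_mul_mono (hF : StrictMono F) (hu : 0 < u) (k : ℕ) :
    ⌊u * F k⌋₊ ≤ ⌊u * F (k + 1)⌋₊ := by
  have : (F k : ℝ) ≤ F (k + 1) := by exact_mod_cast hF.monotone (Nat.le_succ k)
  gcongr

lemma blockEnd_lt_blockStart (hF : StrictMono F) (k : ℕ) : blockEnd F u k < blockStart F u k :=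
  Nat.add_lt_add_right (hF (Nat.lt_succ_self k)) _

lemma blockStart_le_blockEnd (hF : StrictMono F) (hu : 0 < u) (k : ℕ) :
    blockStart F u k ≤ blockEnd F u (k + 1) :=
  Nat.add_le_add_left (floor_mul_mono hF hu k) _

lemma strictMono_blockEnd (hF : StrictMono F) (hu : 0 < u) : StrictMono (blockEnd F u) :=
  strictMono_nat_of_lt_succ fun k =>
    (blockEnd_lt_blockStart hF k).trans_le (blockStart_le_blockEnd hF hu k)

lemma strictMono_blockStart (hF : StrictMono F) (hu : 0 < u) : StrictMono (blockStart F u) :=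
  strictMono_nat_of_lt_succ fun k =>
    (blockStart_le_blockEnd hF hu k).trans_lt (blockEnd_lt_blockStart hF (k + 1))

lemma not_isForced (hF : StrictMono F) (hu : 0 < u) {k i : ℕ} (h1 : blockEnd F u k ≤ i)
    (h2 : i < blockStart F u k) : ¬ IsForced F u i := by
  rintro ⟨l, hl1, hl2⟩
  rcases le_or_gt k l with h | h
  · have := (strictMono_blockStart hF hu).monotone h
    omega
  · have := (strictMono_blockEnd hF hu).monotone (show l + 1 ≤ k from h)
    omega

lemma freeCount_zero : freeCount F u 0 = 0 := by simp [freeCount]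

lemma freeCount_succ_of_forced {i : ℕ} (h : IsForced F u i) :
    freeCount F u (i + 1) = freeCount F u i := by
  simp [freeCount, Nat.count_succ, h]

lemma freeCount_succ_of_free {i : ℕ} (h : ¬ IsForced F u i) :
    freeCount F u (i + 1) = freeCount F u i + 1 := by
  simp [freeCount, Nat.count_succ, h]

lemma freeCount_add_of_free {a m : ℕ} (h : ∀ i, a ≤ i → i < a + m → ¬ IsForced F u i) :
    freeCount F u (a + m) = freeCount F u a + m := by
  induction m with
  | zero => rfl
  | succ m ih =>
    rw [← add_assoc, freeCount_succ_of_free (h (a + m) (by omega) (by omega)),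
      ih fun i h1 h2 => h i h1 (by omega)]
    ring

lemma freeCount_add_of_forced {a m : ℕ} (h : ∀ i, a ≤ i → i < a + m → IsForced F u i) :
    freeCount F u (a + m) = freeCount F u a := by
  induction m with
  | zero => rfl
  | succ m ih =>
    rw [← add_assoc, freeCount_succ_of_forced (h (a + m) (by omega) (by omega)),
      ih fun i h1 h2 => h i h1 (by omega)]

lemma freeCount_blockStart_aux (hF : StrictMono F) (hu : 0 < u) {k n : ℕ}
    (hk : freeCount F u (blockEnd F u k) = F k) (h1 : blockEnd F u k ≤ n)
    (h2 : n ≤ blockStart F u k) : freeCount F u n = F k + (n - blockEnd F u k) := by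
  have := freeCount_add_of_free (F := F) (u := u) (a := blockEnd F u k)
    (m := n - blockEnd F u k) fun i h3 h4 => not_isForced hF hu h3 (by omega)
  rwa [Nat.add_sub_cancel' h1, hk] at this

lemma freeCount_block_aux (hF : StrictMono F) (hu : 0 < u) {k n : ℕ}
    (hk : freeCount F u (blockEnd F u k) = F k) (h1 : blockStart F u k ≤ n)
    (h2 : n ≤ blockEnd F u (k + 1)) : freeCount F u n = F (k + 1) := by
  have := freeCount_add_of_forced (F := F) (u := u) (a := blockStart F u k)
    (m := n - blockStart F u k) fun i h3 h4 => ⟨k, h3, by omega⟩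
  rw [Nat.add_sub_cancel' h1, freeCount_blockStart_aux hF hu hk
    (blockEnd_lt_blockStart hF k).le le_rfl] at this
  rw [this]
  have := hF (Nat.lt_succ_self k)
  simp only [blockStart, blockEnd, Nat.succ_eq_add_one] at *
  omega

lemma freeCount_blockEnd (hF : StrictMono F) (hF0 : F 0 = 0) (hu : 0 < u) (k : ℕ) :
    freeCount F u (blockEnd F u k) = F k := by
  induction k with
  | zero => simp [blockEnd, hF0, freeCount_zero]
  | succ k ih => exact freeCount_block_aux hF hu ih (blockStart_le_blockEnd hF hu k) le_rfl

lemma le_mul_freeCount (hF : StrictMono F) (hF0 : F 0 = 0) (hu : 0 < u) (n : ℕ) :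
    (n : ℝ) ≤ (1 + u) * freeCount F u n := by
  obtain ⟨k, h1, h2⟩ := (strictMono_blockEnd hF hu).exists_le_lt_succ (n := n)
    (by simp [blockEnd, hF0])
  have hk := freeCount_blockEnd hF hF0 hu k
  have hfl : ∀ j, (⌊u * F j⌋₊ : ℝ) ≤ u * F j := fun j => Nat.floor_le (by positivity)
  rcases le_total n (blockStart F u k) with h3 | h3
  · rw [freeCount_blockStart_aux hF hu hk h1 h3]
    obtain ⟨m, rfl⟩ := Nat.exists_eq_add_of_le h1
    rw [Nat.add_sub_cancel_left]
    simp only [blockEnd]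
    push_cast
    have := hfl k
    have hm : (0 : ℝ) ≤ u * m := by positivity
    linarith
  · rw [freeCount_block_aux hF hu hk h3 h2.le]
    have h4 : (n : ℝ) ≤ blockEnd F u (k + 1) := by exact_mod_cast h2.le
    simp only [blockEnd] at h4
    push_cast at h4
    have := hfl (k + 1)
    linarith

/-- The index `i` carries one of the fixed digits that prevent long runs outside the forced
blocks. -/
def IsMarker (F : ℕ → ℕ) (u : ℝ) (N i : ℕ) : Prop :=
  freeCount F u i % N = 0 ∨ freeCount F u i % N = 1

open scoped Classical in
/-- The digit sequence equal to `0` on forced blocks, to `0` and `1` at consecutive markers, and to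
`y` elsewhere. -/
noncomputable def forcedSeq (F : ℕ → ℕ) (u : ℝ) (N : ℕ) (y : ℕ → ℕ) (i : ℕ) : ℕ :=
  if IsForced F u i then 0 else if freeCount F u i % N = 0 then 0
    else if freeCount F u i % N = 1 then 1 else y i

lemma forcedSeq_of_forced {N i : ℕ} {y : ℕ → ℕ} (h : IsForced F u i) :
    forcedSeq F u N y i = 0 := by simp [forcedSeq, h]

lemma forcedSeq_of_marker {N i : ℕ} {y : ℕ → ℕ} (h : IsMarker F u N i) :
    forcedSeq F u N y i ≤ 1 := by
  unfold forcedSeq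
  rcases h with h | h <;> split_ifs <;> omega

lemma forcedSeq_of_free {N i : ℕ} {y : ℕ → ℕ} (h : ¬ IsForced F u i) (h' : ¬ IsMarker F u N i) :
    forcedSeq F u N y i = y i := by
  unfold IsMarker at h'
  push Not at h'
  simp [forcedSeq, h, h']

/-- Outside the forced blocks, runs of `forcedSeq` have length at most `N`. -/
lemma run_le_of_free {N a b : ℕ} (hN : 2 ≤ N) {y : ℕ → ℕ}
    (hfree : ∀ i, a ≤ i → i < b → ¬ IsForced F u i)
    (hrun : ∀ i, a ≤ i → i < b → forcedSeq F u N y i = forcedSeq F u N y a) : b ≤ a + N := by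
  by_contra! hb
  set c := freeCount F u a
  obtain ⟨m, hm, hcm⟩ : ∃ m < N, (c + m) % N = 0 := by
    have hlt := Nat.mod_lt c (show 0 < N by omega)
    by_cases h0 : c % N = 0
    · exact ⟨0, by omega, by simpa using h0⟩
    · refine ⟨N - c % N, by omega, ?_⟩
      rw [Nat.add_mod, Nat.mod_eq_of_lt (show N - c % N < N by omega), Nat.add_sub_cancel' hlt.le,
        Nat.mod_self]
  have hcm1 : (c + (m + 1)) % N = 1 := by
    rw [← add_assoc, Nat.add_mod, hcm, zero_add, Nat.mod_mod, Nat.mod_eq_of_lt (by omega)]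
  have h1 := freeCount_add_of_free (F := F) (u := u) (a := a) (m := m) fun i h1 h2 =>
    hfree i h1 (by omega)
  have h2 := freeCount_add_of_free (F := F) (u := u) (a := a) (m := m + 1) fun i h1 h2 =>
    hfree i h1 (by omega)
  have e1 : forcedSeq F u N y (a + m) = 0 := by
    simp [forcedSeq, h1, c, hcm]
  have e2 : forcedSeq F u N y (a + (m + 1)) = 1 := by
    have := hfree (a + (m + 1)) (by omega) (by omega)
    simp only [forcedSeq, if_neg this, h2]
    rw [if_neg (by simp only [c] at hcm1; omega), if_pos hcm1]
  rw [hrun _ (by omega) (by omega)] at e1 e2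
  omega

lemma runLen_lurothPoint_le (hF : StrictMono F) (hu : 0 < u) {N : ℕ} (hN : 2 ≤ N) (y : ℕ → ℕ)
    {k n : ℕ} (h1 : blockStart F u k ≤ n) (h2 : n ≤ blockStart F u (k + 1)) :
    runLen n (lurothPoint (forcedSeq F u N y)) ≤
      blockEnd F u k + 2 * N + (min n (blockEnd F u (k + 1)) - blockStart F u k) := by
  have hlt := blockEnd_lt_blockStart (u := u) hF k
  obtain ⟨h3, j, hj, hrun⟩ := exists_run_eq_runLen (n := n) (by omega)
    (lurothPoint (forcedSeq F u N y))
  set m := runLen n (lurothPoint (forcedSeq F u N y))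
  have hrun' : ∀ i, j ≤ i → i < j + m → forcedSeq F u N y i = forcedSeq F u N y j := by
    intro i hi1 hi2
    have := hrun (i - j) (by omega)
    rw [show j + (i - j) = i by omega, lurothD_lurothPoint, lurothD_lurothPoint] at this
    omega
  have key : ∀ l, max j (blockEnd F u l) < min (j + m) (blockStart F u l) →
      min (j + m) (blockStart F u l) ≤ max j (blockEnd F u l) + N := by
    intro l hl
    refine run_le_of_free hN (y := y) (fun i hi1 hi2 => not_isForced hF hu (k := l) ?_ ?_)
      fun i hi1 hi2 => ?_
    · omega
    · omega
    · rw [hrun' i (by omega) (by omega), ← hrun' (max j (blockEnd F u l)) (by omega) (by omega)]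
  have k1 := key k
  have k2 := key (k + 1)
  have hle := blockStart_le_blockEnd hF hu k
  omega

lemma le_runLen_lurothPoint {N : ℕ} (y : ℕ → ℕ)
    {k : ℕ} (hlt : blockStart F u k < blockEnd F u (k + 1)) :
    blockEnd F u (k + 1) - blockStart F u k ≤
      runLen (blockEnd F u (k + 1)) (lurothPoint (forcedSeq F u N y)) := by
  refine le_runLen (j := blockStart F u k) (by omega) (by omega) fun i hi => ?_
  rw [lurothD_lurothPoint, lurothD_lurothPoint,
    forcedSeq_of_forced ⟨k, by omega, by omega⟩, forcedSeq_of_forced ⟨k, by omega, by omega⟩]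

lemma lurothPoint_forcedSeq_mem (hF : StrictMono F) (hF0 : F 0 = 0) (hu : 0 < u) {N : ℕ}
    (hN : 2 ≤ N) (hgrow : ∀ ε > 0, ∃ k₀, ∀ k ≥ k₀, (1 + u) * F k + 2 * N ≤ ε * F (k + 1))
    (y : ℕ → ℕ) : lurothPoint (forcedSeq F u N y) ∈ Eab 0 (u / (1 + u)) := by
  set x := lurothPoint (forcedSeq F u N y) with hx
  have hu1 : 0 < 1 + u := by linarith
  have hfl : ∀ j, (⌊u * F j⌋₊ : ℝ) ≤ u * F j := fun j => Nat.floor_le (by positivity)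
  have hend : ∀ k, (blockEnd F u k : ℝ) ≤ (1 + u) * F k := fun k => by
    simp only [blockEnd]; push_cast; linarith [hfl k]
  have hstart : ∀ k, (F (k + 1) : ℝ) ≤ blockStart F u k := fun k => by
    simp only [blockStart]; push_cast; linarith [(Nat.cast_nonneg ⌊u * F k⌋₊ : (0 : ℝ) ≤ _)]
  have hFpos : ∀ k, (0 : ℝ) < F (k + 1) := fun k => by
    have := hF (Nat.succ_pos k)
    rw [hF0] at this
    exact_mod_cast this
  have hb0 : ∀ n, (0 : ℝ) ≤ (runLen n x : ℝ) / n := fun n => (runLen_div_mem n x).1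
  have hb1 : ∀ n, (runLen n x : ℝ) / n ≤ 1 := fun n => (runLen_div_mem n x).2
  have hbd_le : IsBoundedUnder (· ≤ ·) atTop fun n : ℕ => (runLen n x : ℝ) / n :=
    isBoundedUnder_of ⟨1, hb1⟩
  have hbd_ge : IsBoundedUnder (· ≥ ·) atTop fun n : ℕ => (runLen n x : ℝ) / n :=
    isBoundedUnder_of ⟨0, hb0⟩
  refine ⟨lurothPoint_mem _, le_antisymm ?_ ?_, le_antisymm ?_ ?_⟩
  · refine le_of_forall_pos_le_add fun ε hε => ?_
    rw [zero_add]
    obtain ⟨k₀, hk₀⟩ := hgrow ε hε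
    refine liminf_le_of_frequently_le ?_ hbd_ge
    refine frequently_atTop.2 fun A => ?_
    set k := max k₀ A with hk
    have hAk : A ≤ blockStart F u (k + 1) :=
      ((le_max_right k₀ A).trans (Nat.le_succ k)).trans ((strictMono_blockStart hF hu).id_le _)
    refine ⟨blockStart F u (k + 1), hAk, ?_⟩
    have h1 := runLen_lurothPoint_le hF hu hN y (k := k)
      (strictMono_blockStart hF hu (show k < k + 1 by omega)).le le_rfl
    rw [← hx] at h1
    have h2 := blockEnd_lt_blockStart (u := u) hF k
    have h2' := blockStart_le_blockEnd hF hu k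
    have h3 : (runLen (blockStart F u (k + 1)) x : ℝ) ≤ 2 * N + blockEnd F u (k + 1) := by
      exact_mod_cast (show _ ≤ 2 * N + blockEnd F u (k + 1) by omega)
    have h4 := hk₀ (k + 1) ((le_max_left k₀ A).trans (Nat.le_succ k))
    have h5 := hstart (k + 1)
    have h6 := hFpos (k + 1)
    rw [div_le_iff₀ (by linarith)]
    have h7 := hend (k + 1)
    nlinarith
  · exact le_liminf_of_le hbd_le.isCoboundedUnder_ge (Eventually.of_forall hb0)
  · refine le_of_forall_pos_le_add fun ε hε => ?_
    obtain ⟨k₀, hk₀⟩ := hgrow ε hε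
    refine limsup_le_of_le hbd_ge.isCoboundedUnder_le ?_
    filter_upwards [eventually_ge_atTop (blockStart F u k₀)] with n hn
    have hs := strictMono_blockStart hF hu
    obtain ⟨k, h1, h2⟩ := hs.exists_le_lt_succ ((hs.monotone (Nat.zero_le k₀)).trans hn)
    have hkk : k₀ ≤ k := by
      have : k₀ < k + 1 := hs.lt_iff_lt.1 (hn.trans_lt h2)
      omega
    have h3 := runLen_lurothPoint_le hF hu hN y h1 h2.le
    rw [← hx] at h3
    set m := min n (blockEnd F u (k + 1)) with hm
    have hsm : blockStart F u k ≤ m := le_min h1 (blockStart_le_blockEnd hF hu k)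
    have h4 : (runLen n x : ℝ) ≤ blockEnd F u k + 2 * N + (m - blockStart F u k) := by
      rw [← Nat.cast_sub hsm]
      exact_mod_cast h3
    have h5 : (m : ℝ) ≤ n := by exact_mod_cast min_le_left _ _
    have h6 : (m : ℝ) ≤ blockEnd F u (k + 1) := by exact_mod_cast min_le_right _ _
    have h7 := hstart k
    have h8 := hend (k + 1)
    have h9 := hk₀ k hkk
    have h10 : (blockStart F u k : ℝ) ≤ n := by exact_mod_cast h1
    have h11 := hend k
    have hn0 : (0 : ℝ) < n := by linarith [hFpos k]
    rw [div_le_iff₀ hn0]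
    have h12 : (m : ℝ) - blockStart F u k ≤ u / (1 + u) * n := by
      rw [div_mul_eq_mul_div, le_div_iff₀ hu1]
      nlinarith
    nlinarith
  · refine le_of_forall_pos_le_add fun ε hε => ?_
    rw [← sub_le_iff_le_add]
    set δ := min ε (u / 2) with hδ
    have hδ0 : 0 < δ := lt_min hε (by linarith)
    have hδε : δ ≤ ε := min_le_left _ _
    have hδu : δ ≤ u / 2 := min_le_right _ _
    obtain ⟨k₀, hk₀⟩ := hgrow δ hδ0
    refine le_limsup_of_frequently_le ?_ hbd_le
    refine frequently_atTop.2 fun A => ?_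
    set k := max k₀ A with hk
    refine ⟨blockEnd F u (k + 1), ((le_max_right k₀ A).trans (Nat.le_succ k)).trans
      ((strictMono_blockEnd hF hu).id_le _), ?_⟩
    have h1 := hk₀ k (le_max_left _ _)
    have h2 := Nat.lt_floor_add_one (u * F (k + 1))
    have h3 := hfl k
    have hN' : (2 : ℝ) ≤ N := by exact_mod_cast hN
    have h4 := hFpos k
    have hFk : (0 : ℝ) ≤ F k := Nat.cast_nonneg _
    have h5 : (u - δ) * F (k + 1) ≤ (blockEnd F u (k + 1) : ℝ) - blockStart F u k := by
      simp only [blockEnd, blockStart]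
      push_cast
      nlinarith
    have h6 : (blockStart F u k : ℝ) < blockEnd F u (k + 1) := by nlinarith
    have h7 := le_runLen_lurothPoint (N := N) y (Nat.cast_lt.1 h6)
    rw [← hx] at h7
    have h8 : (blockEnd F u (k + 1) : ℝ) - blockStart F u k ≤
        runLen (blockEnd F u (k + 1)) x := by
      rw [← Nat.cast_sub (Nat.cast_lt.1 h6).le]
      exact_mod_cast h7
    have h9 := hend (k + 1)
    have h10 : (0 : ℝ) < blockEnd F u (k + 1) := by
      linarith [(Nat.cast_nonneg (blockStart F u k) : (0 : ℝ) ≤ _)]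
    rw [le_div_iff₀ h10]
    rcases le_total (u / (1 + u) - ε) 0 with h11 | h11
    · nlinarith [(Nat.cast_nonneg (runLen (blockEnd F u (k + 1)) x) : (0 : ℝ) ≤ _)]
    · calc _ ≤ (u / (1 + u) - ε) * ((1 + u) * F (k + 1)) := by gcongr
        _ = (u - ε * (1 + u)) * F (k + 1) := by field_simp
        _ ≤ (u - δ) * F (k + 1) := by gcongr; nlinarith
        _ ≤ _ := h5.trans h8

end Blocks

lemma count_marker_le {N : ℕ} (hN : 2 ≤ N) (n : ℕ) :
    Nat.count (fun m => m % N = 0 ∨ m % N = 1) n ≤ 2 * (n / N + 1) := by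
  have h0 := Nat.count_modEq_card n (show 0 < N by omega) 0
  have h1 := Nat.count_modEq_card n (show 0 < N by omega) 1
  have hle : Nat.count (fun m => m % N = 0 ∨ m % N = 1) n ≤
      Nat.count (· ≡ 0 [MOD N]) n + Nat.count (· ≡ 1 [MOD N]) n := by
    clear h0 h1
    induction n with
    | zero => simp
    | succ n ih =>
      have e0 : n ≡ 0 [MOD N] ↔ n % N = 0 := by simp [Nat.ModEq]
      have e1 : n ≡ 1 [MOD N] ↔ n % N = 1 := by
        rw [Nat.ModEq, Nat.mod_eq_of_lt (show 1 < N by omega)]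
      rw [Nat.count_succ, Nat.count_succ, Nat.count_succ, if_congr e0 rfl rfl, if_congr e1 rfl rfl]
      split_ifs <;> omega
  split_ifs at h0 h1 <;> omega

open scoped Classical in
/-- The mass of the cylinders of `forcedSeq` under a product of weights is controlled by their
lengths. -/
lemma prod_weight_le {F : ℕ → ℕ} {u s Z : ℝ} (hF : StrictMono F) (hF0 : F 0 = 0) (hu : 0 < u)
    (hs : 0 < s) (hZ : 1 < Z) {N : ℕ} (hN : 2 ≤ N)
    (hNZ : ((6 : ℝ) ^ s * 2 ^ (u * s) * Z) ^ 2 ≤ Z ^ N) (y : ℕ → ℕ) (n : ℕ) :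
    ∏ i ∈ Finset.range n, (if IsForced F u i ∨ IsMarker F u N i then 1
      else ((2 : ℝ) ^ (-u) * lurothRho (y i)) ^ s / Z) ≤
    ((6 : ℝ) ^ s * 2 ^ (u * s) * Z) ^ 2 *
      (∏ i ∈ Finset.range n, lurothRho (forcedSeq F u N y i)) ^ s := by
  set K : ℝ := (6 : ℝ) ^ s * 2 ^ (u * s) * Z with hK
  set W : ℕ → ℝ := fun i => if IsForced F u i ∨ IsMarker F u N i then 1
      else ((2 : ℝ) ^ (-u) * lurothRho (y i)) ^ s / Z with hW
  set R : ℕ → ℝ := fun i => lurothRho (forcedSeq F u N y i) ^ s with hR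
  have hZ0 : 0 < Z := by linarith
  have hK1 : 1 ≤ K := by
    have h1 : (1 : ℝ) ≤ 6 ^ s := Real.one_le_rpow (by norm_num) hs.le
    have h2 : (1 : ℝ) ≤ 2 ^ (u * s) := Real.one_le_rpow (by norm_num) (by positivity)
    have h3 : (1 : ℝ) ≤ 6 ^ s * 2 ^ (u * s) := one_le_mul_of_one_le_of_one_le h1 h2
    exact one_le_mul_of_one_le_of_one_le h3 hZ.le
  have hR0 : ∀ i, 0 < R i := fun i => Real.rpow_pos_of_pos (lurothRho_pos _) s
  have hW0 : ∀ i, 0 < W i := fun i => by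
    simp only [hW]
    split_ifs
    · exact one_pos
    · exact div_pos (Real.rpow_pos_of_pos (two_rpow_neg_mul_lurothRho_pos _ _) _) hZ0
  have hRprod : (∏ i ∈ Finset.range n, lurothRho (forcedSeq F u N y i)) ^ s =
      ∏ i ∈ Finset.range n, R i :=
    (Real.finsetProd_rpow _ _ (fun i _ => (lurothRho_pos _).le) s).symm
  rw [hRprod]
  have hmain : ∀ n, (∏ i ∈ Finset.range n, W i) * ((2 : ℝ) ^ (u * s) * Z * 2 ^ s) ^ freeCount F u n
      ≤ (∏ i ∈ Finset.range n, R i) * ((2 : ℝ) ^ s) ^ n *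
        K ^ Nat.count (fun m => m % N = 0 ∨ m % N = 1) (freeCount F u n) := by
    intro n
    induction n with
    | zero => simp [freeCount_zero]
    | succ n ih =>
      rw [Finset.prod_range_succ, Finset.prod_range_succ, pow_succ ((2 : ℝ) ^ s)]
      set PW := ∏ i ∈ Finset.range n, W i
      set PR := ∏ i ∈ Finset.range n, R i
      set c := Nat.count (fun m => m % N = 0 ∨ m % N = 1) (freeCount F u n) with hc
      have hPR : 0 < PR := Finset.prod_pos fun i _ => hR0 i
      have hPW : 0 < PW := Finset.prod_pos fun i _ => hW0 i
      by_cases hf : IsForced F u n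
      · rw [freeCount_succ_of_forced hf, ← hc]
        have h1 : W n = 1 := by simp [hW, hf]
        have h2 : R n * 2 ^ s = 1 := by
          simp only [hR, forcedSeq_of_forced hf, lurothRho_zero]
          rw [← Real.mul_rpow (by norm_num) (by norm_num)]
          norm_num
        calc _ = PW * ((2 : ℝ) ^ (u * s) * Z * 2 ^ s) ^ freeCount F u n := by rw [h1, mul_one]
          _ ≤ _ := ih
          _ = PR * ((2 : ℝ) ^ s) ^ n * K ^ c * (R n * 2 ^ s) := by rw [h2, mul_one]
          _ = _ := by ring
      · rw [freeCount_succ_of_free hf, Nat.count_succ, ← hc, pow_succ ((2 : ℝ) ^ (u * s) * Z * 2 ^ s)]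
        by_cases hm : IsMarker F u N n
        · have hm' := hm
          rw [IsMarker] at hm'
          rw [if_pos hm']
          have h1 : W n = 1 := by simp [hW, hm]
          have h2 : (2 : ℝ) ^ (u * s) * Z * 2 ^ s ≤ R n * 2 ^ s * K := by
            have h3 : 1 ≤ R n * 6 ^ s := by
              simp only [hR]
              rw [← Real.mul_rpow (lurothRho_pos _).le (by norm_num)]
              refine Real.one_le_rpow ?_ hs.le
              have := forcedSeq_of_marker (y := y) hm
              interval_cases forcedSeq F u N y n
              · norm_num [lurothRho_zero]
              · norm_num [lurothRho_one]
            calc _ = 1 * ((2 : ℝ) ^ (u * s) * Z * 2 ^ s) := (one_mul _).symm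
              _ ≤ (R n * 6 ^ s) * ((2 : ℝ) ^ (u * s) * Z * 2 ^ s) := by gcongr
              _ = _ := by rw [hK]; ring
          calc _ = PW * ((2 : ℝ) ^ (u * s) * Z * 2 ^ s) ^ freeCount F u n *
                ((2 : ℝ) ^ (u * s) * Z * 2 ^ s) := by rw [h1]; ring
            _ ≤ (PR * ((2 : ℝ) ^ s) ^ n * K ^ c) * (R n * 2 ^ s * K) := by gcongr
            _ = _ := by ring
        · have hm' := hm
          rw [IsMarker] at hm'
          rw [if_neg hm', add_zero]
          have h1 : W n * ((2 : ℝ) ^ (u * s) * Z * 2 ^ s) = R n * 2 ^ s := by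
            simp only [hW, hR, hf, hm, or_self, if_false, forcedSeq_of_free hf hm]
            rw [Real.mul_rpow (by positivity) (lurothRho_pos _).le, ← Real.rpow_mul (by norm_num),
              neg_mul, Real.rpow_neg (by norm_num)]
            field_simp
          calc _ = PW * ((2 : ℝ) ^ (u * s) * Z * 2 ^ s) ^ freeCount F u n *
                (W n * ((2 : ℝ) ^ (u * s) * Z * 2 ^ s)) := by ring
            _ ≤ (PR * ((2 : ℝ) ^ s) ^ n * K ^ c) * (R n * 2 ^ s) := by
                rw [h1]; have := hR0 n; gcongr
            _ = _ := by ring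
  have hPR : 0 < ∏ i ∈ Finset.range n, R i := Finset.prod_pos fun i _ => hR0 i
  have h := hmain n
  set f := freeCount F u n with hf
  have h2 : ((2 : ℝ) ^ s) ^ n ≤ ((2 : ℝ) ^ (u * s) * 2 ^ s) ^ f := by
    rw [← Real.rpow_add (by norm_num), ← Real.rpow_natCast, ← Real.rpow_natCast,
      ← Real.rpow_mul (by norm_num), ← Real.rpow_mul (by norm_num)]
    refine Real.rpow_le_rpow_of_exponent_le (by norm_num) ?_
    have := le_mul_freeCount hF hF0 hu n
    nlinarith
  have h3 : K ^ Nat.count (fun m => m % N = 0 ∨ m % N = 1) f ≤ K ^ 2 * Z ^ f := by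
    calc _ ≤ K ^ (2 * (f / N + 1)) := pow_le_pow_right₀ hK1 (count_marker_le hN f)
      _ = K ^ 2 * (K ^ 2) ^ (f / N) := by rw [pow_mul, pow_succ']
      _ ≤ K ^ 2 * (Z ^ N) ^ (f / N) := by gcongr
      _ ≤ K ^ 2 * Z ^ f := by
          rw [← pow_mul]
          gcongr
          · exact hZ.le
          · exact Nat.mul_div_le f N
  have hX : (0 : ℝ) < ((2 : ℝ) ^ (u * s) * Z * 2 ^ s) ^ f := by positivity
  refine le_of_mul_le_mul_right ?_ hX
  calc _ ≤ _ := h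
    _ ≤ (∏ i ∈ Finset.range n, R i) * ((2 : ℝ) ^ (u * s) * 2 ^ s) ^ f * (K ^ 2 * Z ^ f) := by
        gcongr
    _ = _ := by simp only [mul_pow]; ring

lemma exists_strictMono_growth : ∃ F : ℕ → ℕ, StrictMono F ∧ F 0 = 0 ∧
    ∀ (a b ε : ℝ), 0 < a → 0 < b → 0 < ε → ∃ k₀, ∀ k ≥ k₀, a * F k + b ≤ ε * F (k + 1) := by
  have hstep : ∀ k : ℕ, (k + 1) * (k * k.factorial) + (k + 1) ≤ (k + 1) * (k + 1).factorial := by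
    intro k
    rw [Nat.factorial_succ]
    have := Nat.factorial_pos k
    nlinarith
  refine ⟨fun k => k * k.factorial, strictMono_nat_of_lt_succ fun k => ?_, by simp, ?_⟩
  · have := hstep k
    nlinarith [Nat.zero_le (k * (k * k.factorial))]
  · intro a b ε ha hb hε
    refine ⟨⌈(a + b) / ε⌉₊, fun k hk => ?_⟩
    have h1 : a + b ≤ ε * k := by
      rw [mul_comm, ← div_le_iff₀ hε]
      exact (Nat.le_ceil _).trans (by exact_mod_cast hk)
    have h2 : ((k : ℝ) + 1) * ((k * k.factorial : ℕ) : ℝ) + (k + 1) ≤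
        (((k + 1) * (k + 1).factorial : ℕ) : ℝ) := by exact_mod_cast hstep k
    have h3 : (0 : ℝ) ≤ ((k * k.factorial : ℕ) : ℝ) := Nat.cast_nonneg _
    have h4 : (0 : ℝ) ≤ k := Nat.cast_nonneg _
    calc _ ≤ (ε * k) * ((k * k.factorial : ℕ) : ℝ) + ε * k := by nlinarith
      _ ≤ ε * (((k : ℝ) + 1) * ((k * k.factorial : ℕ) : ℝ) + (k + 1)) := by nlinarith
      _ ≤ _ := by gcongr

lemma le_dimH_Eab {u s : ℝ} (hu : 0 < u) (hs : 0 < s) {M : ℕ}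
    (hM : 1 < ∑ t : Fin M, ((2 : ℝ) ^ (-u) * lurothRho t) ^ s) :
    ENNReal.ofReal s ≤ dimH (Eab 0 (u / (1 + u))) := by
  classical
  set c : Fin M → ℝ := fun t => ((2 : ℝ) ^ (-u) * lurothRho t) ^ s with hc
  set Z := ∑ t, c t with hZ
  have hZ0 : 0 < Z := by linarith
  have hc0 : ∀ t, 0 < c t := fun t => Real.rpow_pos_of_pos (two_rpow_neg_mul_lurothRho_pos _ _) _
  let ν : Measure (Fin M) := ∑ t, ENNReal.ofReal (c t / Z) • Measure.dirac t
  have hν : ∀ t, ν {t} = ENNReal.ofReal (c t / Z) := fun t => by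
    simp only [ν, Measure.finsetSum_apply, Measure.smul_apply, smul_eq_mul]
    rw [Finset.sum_eq_single t]
    · simp
    · intro b _ hb
      simp [hb]
    · simp
  have : IsProbabilityMeasure ν := ⟨by
    simp only [ν, Measure.finsetSum_apply, Measure.smul_apply, smul_eq_mul, measure_univ, mul_one]
    rw [← ENNReal.ofReal_sum_of_nonneg fun t _ => (div_pos (hc0 t) hZ0).le, ← Finset.sum_div,
      div_self hZ0.ne', ENNReal.ofReal_one]⟩
  obtain ⟨F, hF, hF0, hgrow⟩ := exists_strictMono_growth
  obtain ⟨N, hN, hNZ⟩ : ∃ N, 2 ≤ N ∧ ((6 : ℝ) ^ s * 2 ^ (u * s) * Z) ^ 2 ≤ Z ^ N :=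
    ((eventually_ge_atTop 2).and
      ((tendsto_pow_atTop_atTop_of_one_lt hM).eventually_ge_atTop _)).exists
  let φ : (ℕ → Fin M) → ℕ → ℕ := fun y => forcedSeq F u N fun i => y i
  refine le_dimH_of_measure_cylinder_le (μ := Measure.infinitePi fun _ : ℕ => ν) (φ := φ)
    (M := M + 2) (C := ((6 : ℝ) ^ s * 2 ^ (u * s) * Z) ^ 2) ?_ ?_ hs ?_ fun y =>
      lurothPoint_forcedSeq_mem hF hF0 hu hN (fun ε hε => hgrow _ _ ε (by positivity)
        (by positivity) hε) _
  · refine measurable_pi_iff.2 fun i => ?_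
    simp only [φ, forcedSeq]
    split_ifs
    · exact measurable_const
    · exact measurable_const
    · exact measurable_const
    · exact (measurable_of_countable (fun t : Fin M => (t : ℕ))).comp (measurable_pi_apply i)
  · intro y i
    simp only [φ, forcedSeq]
    have := (y i).isLt
    split_ifs <;> omega
  · intro y n
    have hsub : {y' | ∀ i < n, φ y' i = φ y i} ⊆
        (((Finset.range n).filter fun i => ¬ (IsForced F u i ∨ IsMarker F u N i) : Finset ℕ) :
          Set ℕ).pi fun i => {y i} := by
      intro y' hy' i hi
      simp only [Finset.coe_filter, Finset.mem_range, mem_ofPred_eq, not_or] at hi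
      have := hy' i hi.1
      simp only [φ, forcedSeq_of_free hi.2.1 hi.2.2] at this
      exact Fin.ext this
    refine (measure_mono hsub).trans ?_
    rw [Measure.infinitePi_pi _ fun i _ => measurableSet_singleton _]
    refine le_trans ?_ (ENNReal.ofReal_le_ofReal
      (prod_weight_le hF hF0 hu hs hM hN hNZ (fun i => y i) n))
    rw [ENNReal.ofReal_prod_of_nonneg, Finset.prod_filter]
    · refine (Finset.prod_congr rfl fun i _ => ?_).le
      rw [hν]
      by_cases h : IsForced F u i ∨ IsMarker F u N i
      · simp [h]
      · simp [h, hc]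
    · intro i _
      split_ifs
      · exact zero_le_one
      · exact (div_pos (hc0 (y i)) hZ0).le

/-- For 0 < β < 1, the Hausdorff dimension of E(0,β) equals s(β/(1-β)). -/
theorem luroth_E0β_dimH (S : ℝ → ℝ)
    (hS : ∀ u : ℝ, 0 ≤ u → 1/2 < S u ∧ lurothF u (S u) = 1)
    (β : ℝ) (hβ0 : 0 < β) (hβ1 : β < 1) :
    dimH (Eab 0 β) = ENNReal.ofReal (S (β / (1 - β))) := by
  set u := β / (1 - β) with hudef
  have h1β : 0 < 1 - β := by linarith
  have hu : 0 < u := div_pos hβ0 h1β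
  have huβ : u / (1 + u) = β := by
    rw [hudef]
    field_simp
    ring
  obtain ⟨hS1, hS2⟩ := hS u hu.le
  have hS0 : 0 < S u := by linarith
  apply le_antisymm
  · have hle : ∀ s > S u, dimH (Eab 0 β) ≤ ENNReal.ofReal s := by
      intro s hs
      have hs0 : 0 < s := hS0.trans hs
      obtain ⟨u', hu'0, hu'u, hP⟩ := exists_lt_tsum_mul_lt_one hu hS0 hS2 hs
      have hlt : u' / (1 + u') < β := by
        rw [← huβ, div_lt_div_iff₀ (by linarith) (by linarith)]
        nlinarith
      refine (dimH_mono (Eab_subset_longRunSet hu'0 hlt)).trans ?_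
      refine dimH_le_of_hausdorffMeasure_ne_top (d := s.toNNReal) ?_
      rw [Real.coe_toNNReal s hs0.le]
      exact hausdorffMeasure_longRunSet_ne_top hs0 hu'0 hP
    refine ge_of_tendsto (x := nhdsWithin (S u) (Ioi (S u)))
      (ENNReal.continuous_ofReal.continuousWithinAt.tendsto) ?_
    filter_upwards [self_mem_nhdsWithin] with s hs using hle s hs
  · have hle : ∀ s, 1 / 2 < s → s < S u → ENNReal.ofReal s ≤ dimH (Eab 0 β) := by
      intro s hs hsS
      obtain ⟨M, hM⟩ := exists_one_lt_sum hu hS2 hs hsS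
      rw [← huβ]
      exact le_dimH_Eab hu (by linarith) hM
    refine le_of_tendsto (x := nhdsWithin (S u) (Iio (S u)))
      (ENNReal.continuous_ofReal.continuousWithinAt.tendsto) ?_
    filter_upwards [Ioo_mem_nhdsLT hS1] with s hs using hle s hs.1 hs.2
end
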